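/- arXiv:2110.01855 — 6 statements merged into one kernel-verified Lean document; each statement's English description precedes it below -/
import Mathlib

section
/- Let p be a prime number and c = (c_k)_{k≥0} a bounded sequence of integers such that the p-adic number ξ = Σ_{k≥0} c_k p^k is irrational. Then μ̂×(ξ) = 2/(1 − η̂(c)), with the convention that 2/0 = +∞. -/
open Filter

/-- The rational number `x_m = c₀/p^m + c₁/p^{m-1} + ⋯ + c_{m-1}/p`. -/
noncomputable def xm (p : ℕ) (c : ℕ → ℤ) (m : ℕ) : ℚ :=
  ∑ k ∈ Finset.range m, (c k : ℚ) / (p : ℚ) ^ (m - k)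

/-- The largest partial quotient of the continued fraction expansion of `x`. -/
noncomputable def maxPartQuot (x : ℚ) : ℝ :=
  sSup {r : ℝ | ∃ q ∈ (GenContFract.of x).partDens, r = (q : ℝ)}

/-- `η_m`, the real number such that the largest partial quotient of `x_m` is `p^{η_m m}`. -/
noncomputable def etaSeq (p : ℕ) (c : ℕ → ℤ) (m : ℕ) : ℝ :=
  Real.logb p (maxPartQuot (xm p c m)) / m

noncomputable def uniformMultIrrExp (p : ℕ) [Fact p.Prime] (ξ : ℚ_[p]) : EReal :=
  sSup {e : EReal | ∃ μ : ℝ, e = (μ : EReal) ∧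
    ∀ᶠ X : ℝ in atTop, ∃ a b : ℤ,
      0 < ((|a * b| : ℤ) : ℝ) ^ (1 / 2 : ℝ) ∧
      ((|a * b| : ℤ) : ℝ) ^ (1 / 2 : ℝ) ≤ X ∧
      ‖(b : ℚ_[p]) * ξ - (a : ℚ_[p])‖ ≤ X ^ (-μ)}

open GenContFract in
/-- Consecutive continuants are pairs of integers with determinant `±1`, and the denominators
are positive and nondecreasing. -/
lemma exists_int_contsAux (v : ℝ) (n : ℕ) (ifp : IntFractPair ℝ)
    (h : IntFractPair.stream v n = some ifp) :
    ∃ A B A₀ B₀ : ℤ, (GenContFract.of v).contsAux n = ⟨A₀, B₀⟩ ∧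
      (GenContFract.of v).contsAux (n + 1) = ⟨A, B⟩ ∧
      (A * B₀ - B * A₀) ^ 2 = 1 ∧ 0 ≤ B₀ ∧ B₀ ≤ B ∧ 1 ≤ B := by
  induction n generalizing ifp with
  | zero =>
    exact ⟨⌊v⌋, 1, 1, 0, by simp [contsAux], by simp [contsAux], by simp, by simp, by simp,
      by simp⟩
  | succ n ih =>
    obtain ⟨ifp', h', -, -⟩ := IntFractPair.succ_nth_stream_eq_some_iff.1 h
    obtain ⟨A, B, A₀, B₀, hp, hc, hd, h0, h1, h2⟩ := ih ifp' h'
    have hb := IntFractPair.one_le_succ_nth_stream_b h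
    have hs := get?_of_eq_some_of_succ_get?_intFractPair_stream h
    refine ⟨ifp.b * A + A₀, ifp.b * B + B₀, A, B, hc, ?_, ?_, by omega, by nlinarith, by nlinarith⟩
    · rw [contsAux_recurrence hs hp hc]
      simp
    · rw [← hd]; ring

open GenContFract in
/-- A convergent that is not the last one, in lowest terms, with two-sided bounds for its error in
terms of the next partial quotient. -/
lemma exists_int_convs (v : ℝ) (n : ℕ) (hn : ¬ (GenContFract.of v).TerminatedAt n) :
    ∃ (A B : ℤ) (a : ℝ), (GenContFract.of v).convs n = A / B ∧ IsCoprime A B ∧ 1 ≤ B ∧ 1 ≤ a ∧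
      (GenContFract.of v).partDens.get? n = some a ∧
      1 / (a + 2) ≤ B ^ 2 * |v - A / B| ∧ B ^ 2 * |v - A / B| ≤ 1 / a := by
  rw [of_terminatedAt_n_iff_succ_nth_intFractPair_stream_eq_none] at hn
  obtain ⟨ifp', hs⟩ := Option.ne_none_iff_exists'.1 hn
  obtain ⟨ifp, hst, hfr, hif⟩ := IntFractPair.succ_nth_stream_eq_some_iff.1 hs
  obtain ⟨A, B, A₀, B₀, hp, hc, hd, h0, h1, h2⟩ := exists_int_contsAux v n ifp hst
  have hb := IntFractPair.one_le_succ_nth_stream_b hs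
  have hconv : (GenContFract.of v).convs n = A / B := by
    rw [conv_eq_conts_a_div_conts_b, nth_cont_eq_succ_nth_contAux, hc]
  have hsub := sub_convs_eq hst
  simp only [hp, hc, hfr, if_false, hconv] at hsub
  have hfrac : (ifp'.b : ℝ) ≤ ifp.fr⁻¹ ∧ ifp.fr⁻¹ < ifp'.b + 1 := by
    rw [← hif]
    exact ⟨Int.floor_le _, Int.lt_floor_add_one _⟩
  have h0r : (0 : ℝ) ≤ B₀ := by exact_mod_cast h0
  have h1r : (B₀ : ℝ) ≤ B := by exact_mod_cast h1
  have h2r : (1 : ℝ) ≤ B := by exact_mod_cast h2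
  have hbr : (1 : ℝ) ≤ ifp'.b := by exact_mod_cast hb
  have hpos : 0 < ifp.fr⁻¹ * B + B₀ := by
    have : 0 < ifp.fr⁻¹ * B := mul_pos (by linarith) (by linarith)
    linarith
  have habs : (B : ℝ) ^ 2 * |v - A / B| = B / (ifp.fr⁻¹ * B + B₀) := by
    rw [hsub, abs_div, abs_pow, abs_neg, abs_one, one_pow,
      abs_of_pos (mul_pos (by linarith) hpos)]
    field_simp
  refine ⟨A, B, ifp'.b, hconv, ?_, h2, hbr, ?_, ?_, ?_⟩
  · exact ⟨(A * B₀ - B * A₀) * B₀, -(A * B₀ - B * A₀) * A₀, by rw [← hd]; ring⟩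
  · exact partDen_eq_s_b (get?_of_eq_some_of_succ_get?_intFractPair_stream hs)
  · rw [habs, div_le_div_iff₀ (by linarith) hpos]
    nlinarith
  · rw [habs, div_le_div_iff₀ hpos (by linarith)]
    nlinarith

open GenContFract in
/-- A partial quotient `a` of `v` yields a fraction `A / B` with error at most `1 / (a B²)`. -/
lemma exists_approx_of_mem_partDens (v a : ℝ) (ha : a ∈ (GenContFract.of v).partDens) :
    1 ≤ a ∧ ∃ A B : ℤ, B ≠ 0 ∧ (B : ℝ) * v ≠ A ∧ |(B : ℝ)| * |B * v - A| ≤ 1 / a := by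
  obtain ⟨n, hn⟩ := ha
  have hn' : (GenContFract.of v).partDens.get? n = some a := hn.symm
  have ht : ¬ (GenContFract.of v).TerminatedAt n := by
    rw [terminatedAt_iff_partDen_none, hn']; simp
  obtain ⟨A, B, a', -, -, hB, h1, ha', hl, hu⟩ := exists_int_convs v n ht
  obtain rfl : a' = a := by rw [hn'] at ha'; exact (Option.some.inj ha').symm
  have hBr : (1 : ℝ) ≤ B := by exact_mod_cast hB
  have hB0 : (B : ℝ) ≠ 0 := by linarith
  refine ⟨h1, A, B, by omega, ?_, ?_⟩
  · intro h
    have : v - A / B = 0 := by rw [← h]; field_simp; ring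
    rw [this, abs_zero, mul_zero] at hl
    have : 0 < 1 / (a' + 2) := by positivity
    linarith
  · convert hu using 1
    rw [← abs_mul, ← abs_of_nonneg (sq_nonneg (B : ℝ)), ← abs_mul]
    congr 1
    field_simp

open GenContFract in
/-- A rational approximation of `v` is no better than allowed by some partial quotient of `v`. -/
lemma half_le_or_exists_partDens_le (v : ℝ) (t b : ℤ) (hb : b ≠ 0) (h : (b : ℝ) * v ≠ t) :
    1 / 2 ≤ |(b : ℝ)| * |b * v - t| ∨
      ∃ a ∈ (GenContFract.of v).partDens, 1 ≤ a ∧ 1 / (a + 2) ≤ |(b : ℝ)| * |b * v - t| := by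
  by_cases hlt : 1 / 2 ≤ |(b : ℝ)| * |b * v - t|
  · exact Or.inl hlt
  right
  have hbr : (b : ℝ) ≠ 0 := by exact_mod_cast hb
  have key : |(b : ℝ)| * |b * v - t| = (b : ℝ) ^ 2 * |v - t / b| := by
    rw [← abs_of_nonneg (sq_nonneg (b : ℝ)), ← abs_mul, ← abs_mul]
    congr 1
    field_simp
  rw [key, not_le] at hlt
  set q : ℚ := t / b with hq
  have hqr : (q : ℝ) = t / b := by rw [hq]; push_cast; rfl
  have hden : ((q.den : ℤ)) ∣ b := by
    rw [hq]; exact_mod_cast Rat.den_dvd t b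
  have hdenle : (q.den : ℝ) ^ 2 ≤ (b : ℝ) ^ 2 := by
    have := Int.natAbs_le_of_dvd_ne_zero hden hb
    have h2 : |(q.den : ℤ)| ≤ |b| := by
      rw [Int.abs_eq_natAbs, Int.abs_eq_natAbs]; exact_mod_cast this
    exact_mod_cast sq_le_sq.2 h2
  have hdpos : (0 : ℝ) < (q.den : ℝ) ^ 2 := by
    have := q.den_pos; positivity
  have hleg : |v - q| < 1 / (2 * (q.den : ℝ) ^ 2) := by
    rw [hqr, lt_div_iff₀ (by positivity)]
    nlinarith [abs_nonneg (v - t / b)]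
  obtain ⟨n, hn⟩ := Real.exists_convs_eq_rat hleg
  have ht : ¬ (GenContFract.of v).TerminatedAt n := by
    intro ht
    have := of_correctness_of_terminatedAt ht
    rw [hn, hqr] at this
    apply h
    rw [this]; field_simp
  obtain ⟨A, B, a, hconv, hco, hB, h1, ha', hl, -⟩ := exists_int_convs v n ht
  refine ⟨a, ⟨n, ha'.symm⟩, h1, hl.trans ?_⟩
  have hBr : (1 : ℝ) ≤ B := by exact_mod_cast hB
  have heq : (A : ℝ) / B = t / b := by rw [← hconv, hn, hqr]
  have hcross : A * b = t * B := by
    rw [div_eq_div_iff (by linarith) hbr] at heq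
    exact_mod_cast heq
  have hdvd : B ∣ b := hco.symm.dvd_of_dvd_mul_left ⟨t, by rw [hcross]; ring⟩
  have hle : (B : ℝ) ^ 2 ≤ (b : ℝ) ^ 2 := by
    have := Int.natAbs_le_of_dvd_ne_zero hdvd hb
    have h2 : |B| ≤ |b| := by
      rw [Int.abs_eq_natAbs, Int.abs_eq_natAbs]; exact_mod_cast this
    exact_mod_cast sq_le_sq.2 h2
  rw [key, heq]
  exact mul_le_mul_of_nonneg_right hle (abs_nonneg _)

/-- The partial quotients of a rational number do not change when it is seen as a real number. -/
lemma mem_partDens_coe_iff (x : ℚ) (r : ℝ) :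
    r ∈ (GenContFract.of (x : ℝ)).partDens ↔
      ∃ q ∈ (GenContFract.of x).partDens, r = (q : ℝ) := by
  have key : ∀ n, (GenContFract.of (x : ℝ)).partDens.get? n =
      ((GenContFract.of x).partDens.get? n).map (fun q : ℚ => (q : ℝ)) := by
    intro n
    have := GenContFract.coe_of_s_get?_rat_eq (K := ℝ) (v := (x : ℝ)) (q := x) rfl n
    simp only [GenContFract.partDens, Stream'.Seq.map_get?, ← this, Option.map_map]
    rfl
  constructor
  · rintro ⟨n, hn⟩
    have hn' : (GenContFract.of (x : ℝ)).partDens.get? n = some r := hn.symm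
    rw [key, Option.map_eq_some_iff] at hn'
    obtain ⟨q, hq, rfl⟩ := hn'
    exact ⟨q, ⟨n, hq.symm⟩, rfl⟩
  · rintro ⟨q, ⟨n, hn⟩, rfl⟩
    have hn' : (GenContFract.of x).partDens.get? n = some q := hn.symm
    refine ⟨n, Eq.symm ?_⟩
    change (GenContFract.of (x : ℝ)).partDens.get? n = _
    rw [key, hn']; rfl

/-- The integer `c₀ + c₁ p + ⋯ + c_{m-1} p^{m-1}`. -/
def truncSum (p : ℕ) (c : ℕ → ℤ) (m : ℕ) : ℤ :=
  ∑ k ∈ Finset.range m, c k * (p : ℤ) ^ k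

section

variable (p : ℕ) [hp : Fact p.Prime] (c : ℕ → ℤ)

lemma pow_mul_xm (m : ℕ) : (p : ℝ) ^ m * (xm p c m : ℝ) = truncSum p c m := by
  have hp0 : (p : ℝ) ≠ 0 := by exact_mod_cast hp.out.ne_zero
  simp only [xm, truncSum]
  push_cast
  rw [Finset.mul_sum]
  refine Finset.sum_congr rfl fun k hk => ?_
  have : (p : ℝ) ^ m = p ^ (m - k) * p ^ k := by
    rw [← pow_add, Nat.sub_add_cancel (Finset.mem_range.1 hk).le]
  rw [this]
  field_simp

lemma norm_tsum_sub_truncSum_le (m : ℕ) :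
    ‖(∑' k : ℕ, (c k : ℚ_[p]) * (p : ℚ_[p]) ^ k) - (truncSum p c m : ℚ_[p])‖ ≤
      (p : ℝ) ^ (-m : ℤ) := by
  have hp1 : (1 : ℝ) < p := by exact_mod_cast hp.out.one_lt
  have hterm : ∀ k : ℕ, ‖(c k : ℚ_[p]) * (p : ℚ_[p]) ^ k‖ ≤ ((p : ℝ)⁻¹) ^ k := by
    intro k
    rw [norm_mul, norm_pow, Padic.norm_p]
    have := Padic.norm_int_le_one (p := p) (c k)
    have h2 : 0 ≤ ((p : ℝ)⁻¹) ^ k := by positivity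
    nlinarith
  have hsum : Summable fun k : ℕ => (c k : ℚ_[p]) * (p : ℚ_[p]) ^ k :=
    Summable.of_norm_bounded
      (summable_geometric_of_lt_one (by positivity) (inv_lt_one_of_one_lt₀ hp1)) hterm
  have ht : Tendsto (fun n => (truncSum p c n : ℚ_[p])) atTop
      (nhds (∑' k : ℕ, (c k : ℚ_[p]) * (p : ℚ_[p]) ^ k)) := by
    have := hsum.hasSum.tendsto_sum_nat
    refine this.congr fun n => ?_
    simp [truncSum]
  refine le_of_tendsto (ht.sub_const _).norm ?_
  filter_upwards [eventually_ge_atTop m] with n hn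
  rw [← Int.cast_sub, Padic.norm_int_le_pow_iff_dvd]
  obtain ⟨d, rfl⟩ := Nat.exists_eq_add_of_le hn
  rw [truncSum, truncSum, Finset.sum_range_add, add_sub_cancel_left]
  exact Finset.dvd_sum fun k _ => ⟨c (m + k) * p ^ k, by rw [pow_add]; ring⟩

variable {c} {ξ : ℚ_[p]} (hξ : ξ = ∑' k : ℕ, (c k : ℚ_[p]) * (p : ℚ_[p]) ^ k)
include hξ

lemma norm_mul_sub_le_iff (m : ℕ) (a b : ℤ) :
    ‖(b : ℚ_[p]) * ξ - a‖ ≤ (p : ℝ) ^ (-m : ℤ) ↔ (p : ℤ) ^ m ∣ b * truncSum p c m - a := by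
  have h : ‖(b : ℚ_[p]) * (ξ - truncSum p c m)‖ ≤ (p : ℝ) ^ (-m : ℤ) := by
    rw [norm_mul, hξ]
    exact (mul_le_of_le_one_left (norm_nonneg _) (Padic.norm_int_le_one b)).trans
      (norm_tsum_sub_truncSum_le p c m)
  rw [← Padic.norm_int_le_pow_iff_dvd]
  push_cast
  constructor
  · intro h1
    have : (b : ℚ_[p]) * truncSum p c m - a =
        (b * ξ - a) + -(b * (ξ - truncSum p c m)) := by ring
    rw [this]
    exact (IsUltrametricDist.norm_add_le_max _ _).trans (max_le h1 (by rwa [norm_neg]))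
  · intro h1
    have : (b : ℚ_[p]) * ξ - a =
        (b * truncSum p c m - a) + b * (ξ - truncSum p c m) := by ring
    rw [this]
    exact (IsUltrametricDist.norm_add_le_max _ _).trans (max_le h1 h)

lemma exists_int_of_mem_partDens (m : ℕ) (r : ℝ)
    (hr : r ∈ (GenContFract.of (xm p c m : ℝ)).partDens) :
    ∃ a b : ℤ, a * b ≠ 0 ∧ ((|a * b| : ℤ) : ℝ) ≤ p ^ m / r ∧
      ‖(b : ℚ_[p]) * ξ - a‖ ≤ (p : ℝ) ^ (-m : ℤ) := by
  obtain ⟨-, A, B, hB, hne, hle⟩ := exists_approx_of_mem_partDens _ _ hr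
  have hpm : (0 : ℝ) < (p : ℝ) ^ m := pow_pos (by exact_mod_cast hp.out.pos) m
  have ha : ((B * truncSum p c m - p ^ m * A : ℤ) : ℝ) = p ^ m * (B * (xm p c m : ℝ) - A) := by
    push_cast
    rw [← pow_mul_xm]; ring
  refine ⟨B * truncSum p c m - p ^ m * A, B, ?_, ?_, ?_⟩
  · refine mul_ne_zero (fun h => ?_) hB
    rw [h, Int.cast_zero, eq_comm, mul_eq_zero, sub_eq_zero] at ha
    exact ha.elim hpm.ne' hne
  · rw [Int.cast_abs, Int.cast_mul, ha, abs_mul, abs_mul, abs_of_pos hpm, div_eq_mul_one_div]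
    calc _ = (p : ℝ) ^ m * (|(B : ℝ)| * |B * (xm p c m : ℝ) - A|) := by ring
      _ ≤ _ := mul_le_mul_of_nonneg_left hle hpm.le
  · rw [norm_mul_sub_le_iff p hξ]
    exact ⟨A, by ring⟩

lemma mem_partDens_xm_le (m : ℕ) (r : ℝ)
    (hr : r ∈ (GenContFract.of (xm p c m : ℝ)).partDens) : r ≤ p ^ m := by
  obtain ⟨a, b, h0, hle, -⟩ := exists_int_of_mem_partDens p hξ m r hr
  have h1 : (1 : ℝ) ≤ ((|a * b| : ℤ) : ℝ) := by exact_mod_cast Int.one_le_abs h0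
  have h2 := (exists_approx_of_mem_partDens _ _ hr).1
  have h3 := h1.trans hle
  rwa [le_div_iff₀ (by linarith), one_mul] at h3

lemma le_of_norm_mul_sub_le (m : ℕ) (K : ℝ) (hK : 1 ≤ K)
    (hub : ∀ r ∈ (GenContFract.of (xm p c m : ℝ)).partDens, r ≤ K) (a b : ℤ)
    (hab : a * b ≠ 0) (hn : ‖(b : ℚ_[p]) * ξ - a‖ ≤ (p : ℝ) ^ (-m : ℤ)) :
    (p : ℝ) ^ m / (3 * K) ≤ ((|a * b| : ℤ) : ℝ) := by
  rw [norm_mul_sub_le_iff p hξ] at hn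
  obtain ⟨t, ht⟩ := hn
  have hpm : (0 : ℝ) < (p : ℝ) ^ m := pow_pos (by exact_mod_cast hp.out.pos) m
  have ha : (a : ℝ) = p ^ m * (b * (xm p c m : ℝ) - t) := by
    have h : (b : ℝ) * truncSum p c m - a = p ^ m * t := by exact_mod_cast ht
    rw [← pow_mul_xm] at h
    linarith
  have hne : (b : ℝ) * (xm p c m : ℝ) ≠ t := by
    intro h
    rw [h, sub_self, mul_zero] at ha
    exact left_ne_zero_of_mul hab (by exact_mod_cast ha)
  have hmain : 1 / (3 * K) ≤ |(b : ℝ)| * |b * (xm p c m : ℝ) - t| := by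
    rcases half_le_or_exists_partDens_le _ t b (right_ne_zero_of_mul hab) hne with
      h | ⟨r, hr, h1, h⟩
    · refine le_trans ?_ h
      exact one_div_le_one_div_of_le (by norm_num) (by linarith)
    · refine le_trans ?_ h
      exact one_div_le_one_div_of_le (by linarith) (by linarith [hub r hr])
  rw [Int.cast_abs, Int.cast_mul, ha, abs_mul, abs_mul, abs_of_pos hpm, div_eq_mul_one_div]
  calc _ ≤ (p : ℝ) ^ m * (|(b : ℝ)| * |b * (xm p c m : ℝ) - t|) :=
        mul_le_mul_of_nonneg_left hmain hpm.le
    _ = _ := by ring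

omit hp hξ in
lemma maxPartQuot_eq_sSup_coe (x : ℚ) :
    maxPartQuot x = sSup {r : ℝ | r ∈ (GenContFract.of (x : ℝ)).partDens} := by
  simp only [maxPartQuot, mem_partDens_coe_iff]

lemma le_maxPartQuot_xm (m : ℕ) (r : ℝ)
    (hr : r ∈ (GenContFract.of (xm p c m : ℝ)).partDens) : r ≤ maxPartQuot (xm p c m) := by
  rw [maxPartQuot_eq_sSup_coe]
  exact le_csSup ⟨p ^ m, fun r hr => mem_partDens_xm_le p hξ m r hr⟩ hr

lemma etaSeq_mem_Icc (m : ℕ) : etaSeq p c m ∈ Set.Icc (0 : ℝ) 1 := by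
  have hp1 : (1 : ℝ) < p := by exact_mod_cast hp.out.one_lt
  rw [etaSeq]
  rcases Nat.eq_zero_or_pos m with rfl | hm
  · simp
  rcases Set.eq_empty_or_nonempty {r : ℝ | r ∈ (GenContFract.of (xm p c m : ℝ)).partDens} with
    h | ⟨r, hr⟩
  · rw [maxPartQuot_eq_sSup_coe, h]
    simp
  · have h1 : 1 ≤ maxPartQuot (xm p c m) :=
      (exists_approx_of_mem_partDens _ _ hr).1.trans (le_maxPartQuot_xm p hξ m r hr)
    have h2 : maxPartQuot (xm p c m) ≤ p ^ m := by
      rw [maxPartQuot_eq_sSup_coe]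
      exact csSup_le ⟨r, hr⟩ fun r hr => mem_partDens_xm_le p hξ m r hr
    have hmr : (0 : ℝ) < m := by exact_mod_cast hm
    refine ⟨div_nonneg (Real.logb_nonneg hp1 h1) hmr.le, ?_⟩
    rw [div_le_one hmr, Real.logb_le_iff_le_rpow hp1 (by linarith), Real.rpow_natCast]
    exact h2

/-- Up to constants, `p ^ ((1 - η_m) m)` is the least value of `|a b|` over integers with `a b ≠ 0`
and `|b ξ - a|_p ≤ p ^ (-m)`. -/
lemma eventually_minimal_product (hξ0 : ξ ≠ 0) : ∀ᶠ m : ℕ in atTop,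
    (∃ a b : ℤ, a * b ≠ 0 ∧ ((|a * b| : ℤ) : ℝ) ≤ 2 * (p : ℝ) ^ ((1 - etaSeq p c m) * m) ∧
      ‖(b : ℚ_[p]) * ξ - a‖ ≤ (p : ℝ) ^ (-m : ℤ)) ∧
    ∀ a b : ℤ, a * b ≠ 0 → ‖(b : ℚ_[p]) * ξ - a‖ ≤ (p : ℝ) ^ (-m : ℤ) →
      (p : ℝ) ^ ((1 - etaSeq p c m) * m) / 3 ≤ ((|a * b| : ℤ) : ℝ) := by
  have hp1 : (1 : ℝ) < p := by exact_mod_cast hp.out.one_lt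
  have hlim : Tendsto (fun m : ℕ => (p : ℝ) ^ (-m : ℤ)) atTop (nhds 0) := by
    have := tendsto_pow_atTop_nhds_zero_of_lt_one (r := (p : ℝ)⁻¹) (by positivity)
      (inv_lt_one_of_one_lt₀ hp1)
    refine this.congr fun m => ?_
    simp
  filter_upwards [hlim.eventually (gt_mem_nhds (norm_pos_iff.2 hξ0)), eventually_gt_atTop 0]
    with m hm hm0
  have hmr : (m : ℝ) ≠ 0 := by exact_mod_cast hm0.ne'
  have hpm : (0 : ℝ) < (p : ℝ) ^ m := by positivity
  have hfr : Int.fract (xm p c m : ℝ) ≠ 0 := by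
    intro h
    have hz : (xm p c m : ℝ) = ⌊(xm p c m : ℝ)⌋ := by
      have := Int.floor_add_fract (xm p c m : ℝ)
      rw [h, add_zero] at this
      exact this.symm
    have hN := pow_mul_xm p c m
    rw [hz] at hN
    have : ‖((1 : ℤ) : ℚ_[p]) * ξ - (0 : ℤ)‖ ≤ (p : ℝ) ^ (-m : ℤ) := by
      rw [norm_mul_sub_le_iff p hξ]
      exact ⟨⌊(xm p c m : ℝ)⌋, by
        rw [one_mul, sub_zero]
        exact_mod_cast hN.symm⟩
    simp only [Int.cast_one, one_mul, Int.cast_zero, sub_zero] at this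
    linarith
  have hhead := GenContFract.of_s_head hfr
  have hne : {r : ℝ | r ∈ (GenContFract.of (xm p c m : ℝ)).partDens}.Nonempty :=
    ⟨_, 0, (GenContFract.partDen_eq_s_b hhead).symm⟩
  obtain ⟨r₀, hr₀⟩ := hne
  have hub := le_maxPartQuot_xm p hξ m
  have hK : 1 ≤ maxPartQuot (xm p c m) :=
    (exists_approx_of_mem_partDens _ _ hr₀).1.trans (hub r₀ hr₀)
  have hpow : (p : ℝ) ^ ((1 - etaSeq p c m) * m) = p ^ m / maxPartQuot (xm p c m) := by
    have : (1 - etaSeq p c m) * m = m - Real.logb p (maxPartQuot (xm p c m)) := by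
      rw [etaSeq]; field_simp
    rw [this, Real.rpow_sub (by linarith), Real.rpow_natCast,
      Real.rpow_logb (by linarith) hp1.ne' (by linarith)]
  rw [hpow]
  constructor
  · obtain ⟨r, hr, hlt⟩ : ∃ r ∈ {r : ℝ | r ∈ (GenContFract.of (xm p c m : ℝ)).partDens},
        maxPartQuot (xm p c m) / 2 < r := by
      refine exists_lt_of_lt_csSup ⟨r₀, hr₀⟩ ?_
      rw [← maxPartQuot_eq_sSup_coe]
      linarith
    obtain ⟨a, b, h0, hle, hn⟩ := exists_int_of_mem_partDens p hξ m r hr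
    refine ⟨a, b, h0, hle.trans ?_, hn⟩
    rw [← mul_div_assoc, div_le_div_iff₀ (by linarith) (by linarith)]
    nlinarith
  · intro a b h0 hn
    have := le_of_norm_mul_sub_le p hξ m _ hK hub a b h0 hn
    rwa [div_div, mul_comm (maxPartQuot _)]

end

section

variable (p : ℕ) [hp : Fact p.Prime] {c : ℕ → ℤ} {ξ : ℚ_[p]}

/-- The exponent `μ` is achieved in the definition of `uniformMultIrrExp p ξ`. -/
def IsUniformMultExponent (ξ : ℚ_[p]) (μ : ℝ) : Prop :=
  ∀ᶠ X : ℝ in atTop, ∃ a b : ℤ,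
    0 < ((|a * b| : ℤ) : ℝ) ^ (1 / 2 : ℝ) ∧
    ((|a * b| : ℤ) : ℝ) ^ (1 / 2 : ℝ) ≤ X ∧
    ‖(b : ℚ_[p]) * ξ - (a : ℚ_[p])‖ ≤ X ^ (-μ)

variable (hξ : ξ = ∑' k : ℕ, (c k : ℚ_[p]) * (p : ℚ_[p]) ^ k) (hξ0 : ξ ≠ 0)
include hξ

lemma isBoundedUnder_ge_etaSeq : IsBoundedUnder (· ≥ ·) atTop (etaSeq p c) :=
  isBoundedUnder_of ⟨0, fun m => (etaSeq_mem_Icc p hξ m).1⟩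

lemma isCoboundedUnder_ge_etaSeq : IsCoboundedUnder (· ≥ ·) atTop (etaSeq p c) :=
  (isBoundedUnder_of ⟨1, fun m => (etaSeq_mem_Icc p hξ m).2⟩ :
    IsBoundedUnder (· ≤ ·) atTop (etaSeq p c)).isCoboundedUnder_ge

lemma liminf_etaSeq_le_one : liminf (etaSeq p c) atTop ≤ 1 :=
  liminf_le_of_le (isBoundedUnder_ge_etaSeq p hξ) fun _ hb =>
    hb.exists.elim fun m hm => hm.trans (etaSeq_mem_Icc p hξ m).2

include hξ0

lemma isUniformMultExponent_of_lt {μ : ℝ} (hμ : 0 < μ)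
    (h : μ * (1 - liminf (etaSeq p c) atTop) < 2) : IsUniformMultExponent p ξ μ := by
  have hp1 : (1 : ℝ) < p := by exact_mod_cast hp.out.one_lt
  have hp0 : (0 : ℝ) < p := by linarith
  obtain ⟨s, hs, hs2⟩ : ∃ s < liminf (etaSeq p c) atTop, μ * (1 - s) < 2 := by
    refine ⟨liminf (etaSeq p c) atTop - (2 - μ * (1 - liminf (etaSeq p c) atTop)) / (2 * μ),
      sub_lt_self _ (div_pos (by linarith) (by linarith)), ?_⟩
    have : μ * ((2 - μ * (1 - liminf (etaSeq p c) atTop)) / (2 * μ)) =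
        (2 - μ * (1 - liminf (etaSeq p c) atTop)) / 2 := by field_simp
    rw [mul_sub, mul_sub, this]
    linarith
  have hev := (eventually_lt_of_lt_liminf hs (isBoundedUnder_ge_etaSeq p hξ)).and
    (eventually_minimal_product p hξ hξ0)
  have hs1 : s < 1 := hs.trans_le (liminf_etaSeq_le_one p hξ)
  have hlog : Tendsto (fun X : ℝ => Real.logb p X) atTop atTop := Real.tendsto_logb_atTop hp1
  have hceil : Tendsto (fun X : ℝ => ⌈μ * Real.logb p X⌉₊) atTop atTop :=
    tendsto_nat_ceil_atTop.comp (hlog.const_mul_atTop hμ)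
  filter_upwards [hceil.eventually hev, hlog.eventually_ge_atTop 0, eventually_gt_atTop 0,
    hlog.eventually_ge_atTop ((Real.logb p 2 + (1 - s)) / (2 - μ * (1 - s)))]
    with X ⟨hη, ⟨a, b, hab, hle, hn⟩, _⟩ hL0 hX0 hL
  set L := Real.logb p X
  set m := ⌈μ * L⌉₊
  have hm1 : μ * L ≤ m := Nat.le_ceil _
  have hm2 : (m : ℝ) < μ * L + 1 := Nat.ceil_lt_add_one (by positivity)
  have hXL : X = (p : ℝ) ^ L := (Real.rpow_logb hp0 hp1.ne' hX0).symm
  have habpos : (0 : ℝ) < ((|a * b| : ℤ) : ℝ) := by exact_mod_cast abs_pos.2 hab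
  refine ⟨a, b, Real.rpow_pos_of_pos habpos _, ?_, hn.trans ?_⟩
  · rw [← Real.sqrt_eq_rpow, Real.sqrt_le_left hX0.le]
    refine hle.trans ?_
    have h2 : (2 : ℝ) = (p : ℝ) ^ Real.logb p 2 :=
      (Real.rpow_logb hp0 hp1.ne' (by norm_num)).symm
    have hX2 : X ^ 2 = (p : ℝ) ^ (L * 2) := by
      rw [hXL, Real.rpow_mul hp0.le]; norm_cast
    nth_rewrite 1 [h2]
    rw [hX2, ← Real.rpow_add hp0]
    refine Real.rpow_le_rpow_of_exponent_le hp1.le ?_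
    have h3 : (1 - etaSeq p c m) * m ≤ (1 - s) * (μ * L + 1) :=
      mul_le_mul (by linarith) hm2.le (Nat.cast_nonneg _) (by linarith)
    rw [div_le_iff₀ (by linarith)] at hL
    nlinarith
  · rw [hXL, ← Real.rpow_mul hp0.le, ← Real.rpow_intCast]
    refine Real.rpow_le_rpow_of_exponent_le hp1.le ?_
    push_cast
    linarith

lemma IsUniformMultExponent.mul_le {μ : ℝ} (hμ : 0 < μ) (h : IsUniformMultExponent p ξ μ) :
    μ * (1 - liminf (etaSeq p c) atTop) ≤ 2 := by
  by_contra! hlt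
  have hp1 : (1 : ℝ) < p := by exact_mod_cast hp.out.one_lt
  have hp0 : (0 : ℝ) < p := by linarith
  obtain ⟨s, hs, hs2⟩ : ∃ s > liminf (etaSeq p c) atTop, 2 < μ * (1 - s) := by
    refine ⟨liminf (etaSeq p c) atTop + (μ * (1 - liminf (etaSeq p c) atTop) - 2) / (2 * μ),
      lt_add_of_pos_right _ (div_pos (by linarith) (by linarith)), ?_⟩
    have : μ * ((μ * (1 - liminf (etaSeq p c) atTop) - 2) / (2 * μ)) =
        (μ * (1 - liminf (etaSeq p c) atTop) - 2) / 2 := by field_simp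
    rw [mul_sub, mul_add, this]
    linarith
  have hfreq := frequently_lt_of_liminf_lt (isCoboundedUnder_ge_etaSeq p hξ) hs
  have hcast : Tendsto (fun m : ℕ => (m : ℝ) / μ) atTop atTop :=
    tendsto_natCast_atTop_atTop.atTop_div_const hμ
  have hX : Tendsto (fun m : ℕ => (p : ℝ) ^ ((m : ℝ) / μ)) atTop atTop :=
    (tendsto_rpow_atTop_of_base_gt_one _ hp1).comp hcast
  obtain ⟨m, hη, ⟨-, hmin⟩, ⟨a, b, hpos, hle, hn⟩, hm⟩ :=
    (hfreq.and_eventually ((eventually_minimal_product p hξ hξ0).and ((hX.eventually h).and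
      (hcast.eventually_gt_atTop (Real.logb p 3 / (μ * (1 - s) - 2)))))).exists
  have hab : a * b ≠ 0 := by
    intro h0
    rw [h0] at hpos
    norm_num at hpos
  rw [← Real.rpow_mul hp0.le] at hn
  have hn' : ‖(b : ℚ_[p]) * ξ - a‖ ≤ (p : ℝ) ^ (-m : ℤ) := by
    refine hn.trans_eq ?_
    rw [← Real.rpow_intCast]
    congr 1
    push_cast
    field_simp
  have h1 := hmin a b hab hn'
  rw [← Real.sqrt_eq_rpow, Real.sqrt_le_left (by positivity)] at hle
  have h2 := h1.trans hle
  have h3 : (3 : ℝ) = (p : ℝ) ^ Real.logb p 3 :=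
    (Real.rpow_logb hp0 hp1.ne' (by norm_num)).symm
  rw [div_le_iff₀ (by norm_num), ← Real.rpow_mul_natCast hp0.le, h3, ← Real.rpow_add hp0,
    Real.rpow_le_rpow_left_iff hp1] at h2
  rw [div_lt_iff₀ (by linarith)] at hm
  have h4 : (1 - s) * m ≤ (1 - etaSeq p c m) * m :=
    mul_le_mul_of_nonneg_right (by linarith) (Nat.cast_nonneg _)
  have h5 : (m : ℝ) / μ * (μ * (1 - s) - 2) = (1 - s) * m - m / μ * 2 := by
    field_simp
  push_cast at h2
  linarith

end

theorem uniformMultIrrExp_eq (p : ℕ) [Fact p.Prime] (c : ℕ → ℤ)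
    (hc : ∃ B : ℝ, ∀ k, |(c k : ℝ)| ≤ B)
    (ξ : ℚ_[p]) (hξ : ξ = ∑' k : ℕ, (c k : ℚ_[p]) * (p : ℚ_[p]) ^ k)
    (hirr : ∀ q : ℚ, ξ ≠ (q : ℚ_[p])) :
    uniformMultIrrExp p ξ =
      if liminf (etaSeq p c) atTop = 1 then (⊤ : EReal)
      else ((2 / (1 - liminf (etaSeq p c) atTop) : ℝ) : EReal) := by
  have hξ0 : ξ ≠ 0 := fun h => hirr 0 (by simpa using h)
  have hle1 := liminf_etaSeq_le_one p hξ
  have hmem : ∀ μ : ℝ, 0 < μ → μ * (1 - liminf (etaSeq p c) atTop) < 2 →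
      (μ : EReal) ≤ uniformMultIrrExp p ξ := fun μ hμ h =>
    le_sSup ⟨μ, rfl, isUniformMultExponent_of_lt p hξ hξ0 hμ h⟩
  split_ifs with h1
  · rw [EReal.eq_top_iff_forall_lt]
    intro y
    have h2 : (y : EReal) < ((max y 0 + 1 : ℝ) : EReal) :=
      EReal.coe_lt_coe_iff.2 (by linarith [le_max_left y 0])
    exact h2.trans_le (hmem _ (by positivity) (by rw [h1]; norm_num))
  · have hpos : 0 < 1 - liminf (etaSeq p c) atTop := sub_pos.2 (lt_of_le_of_ne hle1 h1)
    refine le_antisymm (sSup_le ?_) (le_of_forall_lt fun y hy => ?_)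
    · rintro _ ⟨μ, rfl, hμ⟩
      rw [EReal.coe_le_coe_iff, le_div_iff₀ hpos]
      rcases le_or_gt μ 0 with h0 | h0
      · nlinarith
      · exact IsUniformMultExponent.mul_le p hξ hξ0 h0 hμ
    · obtain ⟨r, hyr, hr⟩ := EReal.lt_iff_exists_real_btwn.1 hy
      rw [EReal.coe_lt_coe_iff] at hr
      refine hyr.trans_le ((EReal.coe_le_coe_iff.2 (le_max_left r _)).trans
        (hmem (max r (1 / (1 - liminf (etaSeq p c) atTop)))
          (lt_max_of_lt_right (by positivity)) ?_))
      rw [← lt_div_iff₀ hpos]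
      exact max_lt hr (by gcongr; norm_num)
end

section
/- Let p be a prime number and c = (c_k)_{k≥0} a bounded sequence of integers. For every ε > 0 there exists an integer M such that for all integers m, u, n with M ≤ m ≤ u ≤ n one has η_u ≤ (n(1 + η_n) − m(1 − η_m))/(n(1 + η_n) + m(1 − η_m)) + ε. -/
open Filter

namespace GenContFract

/-- The continuants of the continued fraction of a rational number are integers. -/
theorem exists_int_of_contsAux (x : ℚ) (n : ℕ) :
    ∃ a b : ℤ, (GenContFract.of x).contsAux n = ⟨(a : ℚ), (b : ℚ)⟩ := by
  suffices h : (∃ a b : ℤ, (GenContFract.of x).contsAux n = ⟨(a : ℚ), (b : ℚ)⟩) ∧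
      ∃ a b : ℤ, (GenContFract.of x).contsAux (n + 1) = ⟨(a : ℚ), (b : ℚ)⟩ from h.1
  induction n with
  | zero =>
    refine ⟨⟨1, 0, by simp [contsAux]⟩, ⟨⌊x⌋, 1, by simp [contsAux]⟩⟩
  | succ n ih =>
    refine ⟨ih.2, ?_⟩
    obtain ⟨⟨a, b, h₀⟩, ⟨a', b', h₁⟩⟩ := ih
    by_cases ht : (GenContFract.of x).TerminatedAt n
    · exact ⟨a', b', by rw [contsAux_stable_step_of_terminated ht, h₁]⟩
    · obtain ⟨gp, hgp⟩ := Option.ne_none_iff_exists'.1 (mt terminatedAt_iff_s_none.2 ht)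
      obtain ⟨ha, z, hz⟩ := of_partNum_eq_one_and_exists_int_partDen_eq hgp
      refine ⟨z * a' + a, z * b' + b, ?_⟩
      rw [contsAux_recurrence hgp h₀ h₁, ha, hz]
      push_cast
      simp

theorem exists_int_eq_num (x : ℚ) (n : ℕ) : ∃ a : ℤ, (GenContFract.of x).nums n = a := by
  obtain ⟨a, b, h⟩ := exists_int_of_contsAux x (n + 1)
  exact ⟨a, by rw [num_eq_conts_a, nth_cont_eq_succ_nth_contAux, h]⟩

theorem exists_int_eq_den (x : ℚ) (n : ℕ) : ∃ b : ℤ, (GenContFract.of x).dens n = b := by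
  obtain ⟨a, b, h⟩ := exists_int_of_contsAux x (n + 1)
  exact ⟨b, by rw [den_eq_conts_b, nth_cont_eq_succ_nth_contAux, h]⟩

theorem one_le_den (x : ℚ) (n : ℕ) : 1 ≤ (GenContFract.of x).dens n := by
  induction n with
  | zero => simp
  | succ n ih => exact ih.trans of_den_mono

theorem den_succ_le (x b : ℚ) (n : ℕ) (hb : (GenContFract.of x).partDens.get? n = some b) :
    (GenContFract.of x).dens (n + 1) ≤ (b + 1) * (GenContFract.of x).dens n := by
  obtain ⟨gp, hgp, rfl⟩ := exists_s_b_of_partDen hb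
  have ha := (of_partNum_eq_one_and_exists_int_partDen_eq hgp).1
  have hmono : ((GenContFract.of x).contsAux n).b ≤ (GenContFract.of x).dens n := by
    cases n with
    | zero => simp [contsAux]
    | succ n =>
      have := of_den_mono (v := x) (n := n)
      rwa [den_eq_conts_b, nth_cont_eq_succ_nth_contAux] at this
  rw [den_eq_conts_b (n := n + 1), nth_cont_eq_succ_nth_contAux,
    contsAux_recurrence hgp rfl rfl, ha]
  have h : ((GenContFract.of x).contsAux (n + 1)).b = (GenContFract.of x).dens n := by
    rw [den_eq_conts_b, nth_cont_eq_succ_nth_contAux]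
  simp only [h]
  linarith

theorem ne_convs_of_not_terminatedAt (x : ℚ) (n : ℕ) (h : ¬(GenContFract.of x).TerminatedAt n) :
    x ≠ (GenContFract.of x).convs n := by
  rw [of_terminatedAt_n_iff_succ_nth_intFractPair_stream_eq_none] at h
  obtain ⟨ifp', h'⟩ := Option.ne_none_iff_exists'.1 h
  obtain ⟨ifp, hifp, hfr, -⟩ := IntFractPair.succ_nth_stream_eq_some_iff.1 h'
  have hs := sub_convs_eq hifp
  have hB : 1 ≤ ((GenContFract.of x).contsAux (n + 1)).b := by
    have := one_le_den x n
    rwa [den_eq_conts_b, nth_cont_eq_succ_nth_contAux] at this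
  have hpB : 0 ≤ ((GenContFract.of x).contsAux n).b := zero_le_of_contsAux_b
  have hfr' : 0 < ifp.fr := (IntFractPair.nth_stream_fr_nonneg hifp).lt_of_ne' hfr
  rw [← sub_ne_zero]
  simp only [hfr, if_false] at hs
  rw [hs]
  refine div_ne_zero (by simp) (ne_of_gt ?_)
  positivity

theorem abs_den_mul_sub_num (x : ℚ) (n : ℕ) :
    |(GenContFract.of x).dens n * x - (GenContFract.of x).nums n| =
      (GenContFract.of x).dens n * |x - (GenContFract.of x).convs n| := by
  have h := one_le_den x n
  rw [← abs_of_pos (zero_lt_one.trans_le h), ← abs_mul, abs_of_pos (zero_lt_one.trans_le h),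
    conv_eq_num_div_den]
  congr 1
  field_simp

theorem abs_den_mul_sub_num_le (x : ℚ) (n : ℕ) (h : ¬(GenContFract.of x).TerminatedAt n) :
    (GenContFract.of x).dens (n + 1) * |(GenContFract.of x).dens n * x -
      (GenContFract.of x).nums n| ≤ 1 := by
  have h₀ := one_le_den x n
  have h₁ := one_le_den x (n + 1)
  rw [abs_den_mul_sub_num]
  calc _ ≤ (GenContFract.of x).dens (n + 1) * ((GenContFract.of x).dens n *
          (1 / ((GenContFract.of x).dens n * (GenContFract.of x).dens (n + 1)))) := by
        gcongr
        exact abs_sub_convs_le h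
    _ = 1 := by field_simp

theorem den_mul_abs_le_one (x : ℚ) (n : ℕ) :
    (GenContFract.of x).dens n * |(GenContFract.of x).dens n * x -
      (GenContFract.of x).nums n| ≤ 1 := by
  by_cases h : (GenContFract.of x).TerminatedAt n
  · rw [abs_den_mul_sub_num, ← of_correctness_of_terminatedAt h]
    simp
  · refine le_trans ?_ (abs_den_mul_sub_num_le x n h)
    gcongr
    exact of_den_mono

/-- A partial quotient `b` of `x` yields a rational approximation of `x` of quality `1 / b`. -/
theorem exists_approx_of_mem_partDens {x b : ℚ} (hb : b ∈ (GenContFract.of x).partDens) :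
    ∃ q r : ℤ, 1 ≤ q ∧ (q : ℚ) * x - r ≠ 0 ∧ b * (q * |(q : ℚ) * x - r|) ≤ 1 := by
  obtain ⟨n, hn⟩ := Stream'.Seq.mem_iff_exists_get?.1 hb
  replace hn := hn.symm
  have ht : ¬(GenContFract.of x).TerminatedAt n := by simp [terminatedAt_iff_partDen_none, hn]
  obtain ⟨r, hr⟩ := exists_int_eq_num x n
  obtain ⟨q, hq⟩ := exists_int_eq_den x n
  have h1 := one_le_den x n
  have hne := ne_convs_of_not_terminatedAt x n ht
  refine ⟨q, r, ?_, ?_, ?_⟩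
  · rw [hq] at h1
    exact_mod_cast h1
  · rw [← hq, ← hr, ← abs_pos, abs_den_mul_sub_num]
    have := abs_pos.2 (sub_ne_zero.2 hne)
    positivity
  · rw [← hq, ← hr, ← mul_assoc]
    refine le_trans ?_ (abs_den_mul_sub_num_le x n ht)
    gcongr
    exact le_of_succ_get?_den hn

theorem one_le_abs_of_int {z : ℤ} {x : ℚ} (h : x = z) (hx : x ≠ 0) : 1 ≤ |x| := by
  subst h
  exact_mod_cast Int.one_le_abs (by exact_mod_cast hx)

/-- The quality of a rational approximation of `x` is bounded in terms of a partial quotient. -/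
theorem one_le_mul_approx {x : ℚ} {q r : ℤ} (hq : 1 ≤ q) (hne : (q : ℚ) * x - r ≠ 0) :
    1 ≤ 4 * (q * |(q : ℚ) * x - r|) ∨
      ∃ b ∈ (GenContFract.of x).partDens, 1 ≤ 4 * (b + 1) * (q * |(q : ℚ) * x - r|) := by
  have hq' : (1 : ℚ) ≤ q := by exact_mod_cast hq
  set θ := |(q : ℚ) * x - r| with hθ
  have hθ0 : 0 ≤ θ := abs_nonneg _
  by_cases hlarge : ∃ n, 2 * (q : ℚ) < (GenContFract.of x).dens n
  · classical
    obtain ⟨n, hn⟩ : ∃ n, Nat.find hlarge = n + 1 := by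
      refine Nat.exists_eq_succ_of_ne_zero fun h => ?_
      have := Nat.find_spec hlarge
      rw [h] at this
      simp at this
      linarith
    have hbig := Nat.find_spec hlarge
    rw [hn] at hbig
    have hsmall : (GenContFract.of x).dens n ≤ 2 * q := not_lt.1 (Nat.find_min hlarge (by omega))
    have ht : ¬(GenContFract.of x).TerminatedAt n := by
      intro h
      rw [dens_stable_of_terminated n.le_succ h] at hbig
      linarith
    obtain ⟨b, hb⟩ := Option.ne_none_iff_exists'.1 (mt terminatedAt_iff_partDen_none.2 ht)
    have hden := den_succ_le x b n hb
    have hδ₀ := abs_den_mul_sub_num_le x n ht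
    have hδ₁ := den_mul_abs_le_one x (n + 1)
    have hdet : (GenContFract.of x).nums n * (GenContFract.of x).dens (n + 1) -
        (GenContFract.of x).dens n * (GenContFract.of x).nums (n + 1)
        = (-1) ^ (n + 1) := (SimpContFract.of x).determinant ht
    have h1 := one_le_den x n
    obtain ⟨P₀, hP₀⟩ := exists_int_eq_num x n
    obtain ⟨Q₀, hQ₀⟩ := exists_int_eq_den x n
    obtain ⟨P₁, hP₁⟩ := exists_int_eq_num x (n + 1)
    obtain ⟨Q₁, hQ₁⟩ := exists_int_eq_den x (n + 1)
    simp only [hP₀, hQ₀, hP₁, hQ₁] at hbig hsmall hden hδ₀ hδ₁ hdet h1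
    have key : ∀ P Q : ℤ, 1 ≤ (Q : ℚ) → (q : ℚ) * P - r * Q ≠ 0 →
        2 * q * |(Q : ℚ) * x - P| ≤ 1 → 1 ≤ 2 * (Q * θ) := by
      intro P Q hQ h hle
      have hge : 1 ≤ |(q : ℚ) * P - r * Q| :=
        one_le_abs_of_int (z := q * P - r * Q) (by push_cast; rfl) h
      have heq : (q : ℚ) * P - r * Q = Q * (q * x - r) - q * (Q * x - P) := by ring
      have := abs_sub ((Q : ℚ) * (q * x - r)) (q * (Q * x - P))
      rw [← heq, abs_mul, abs_mul, abs_of_pos (by linarith : (0 : ℚ) < Q),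
        abs_of_pos (by linarith : (0 : ℚ) < q), ← hθ] at this
      linarith
    by_cases hprop : (q : ℚ) * P₀ - r * Q₀ = 0
    · refine Or.inr ⟨b, Stream'.Seq.mem_iff_exists_get?.2 ⟨n, hb.symm⟩, ?_⟩
      have hb1 : 1 ≤ b := of_one_le_get?_partDen hb
      have hprop' : (q : ℚ) * P₁ - r * Q₁ ≠ 0 := by
        intro h
        have : (q : ℚ) * (-1) ^ (n + 1) = 0 := by
          rw [← hdet]
          linear_combination (Q₁ : ℚ) * hprop - (Q₀ : ℚ) * h
        simp at this
        omega
      have := key P₁ Q₁ (by linarith) hprop'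
        ((mul_le_mul_of_nonneg_right hbig.le (abs_nonneg _)).trans hδ₁)
      have hle : (Q₁ : ℚ) ≤ (b + 1) * (2 * q) :=
        hden.trans (by gcongr)
      nlinarith
    · left
      have := key P₀ Q₀ h1 hprop
        ((mul_le_mul_of_nonneg_right hbig.le (abs_nonneg _)).trans hδ₀)
      nlinarith
  · left
    push Not at hlarge
    obtain ⟨n, hn⟩ := terminates_of_rat x
    have hQ := hlarge n
    have h1 := one_le_den x n
    have hc := abs_den_mul_sub_num x n
    rw [← of_correctness_of_terminatedAt hn, sub_self, abs_zero, mul_zero, abs_eq_zero] at hc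
    obtain ⟨P, hP⟩ := exists_int_eq_num x n
    obtain ⟨Q, hQ'⟩ := exists_int_eq_den x n
    rw [hP, hQ'] at hc
    rw [hQ'] at hQ h1
    have hQpos : (0 : ℚ) < Q := by linarith
    have := one_le_abs_of_int (z := q * P - Q * r) (x := Q * (q * x - r))
      (by push_cast; linear_combination (q : ℚ) * hc) (mul_ne_zero hQpos.ne' hne)
    rw [abs_mul, abs_of_pos hQpos, ← hθ] at this
    nlinarith

end GenContFract

open GenContFract

theorem le_of_mem_partDens {x b : ℚ} {D : ℕ} (hD : 1 ≤ D) {z : ℤ} (hz : (D : ℚ) * x = z)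
    (hb : b ∈ (GenContFract.of x).partDens) : b ≤ D := by
  obtain ⟨q, r, hq, hne, hle⟩ := exists_approx_of_mem_partDens hb
  have hD' : (1 : ℚ) ≤ D := by exact_mod_cast hD
  have hq' : (1 : ℚ) ≤ q := by exact_mod_cast hq
  have h := one_le_abs_of_int (z := q * z - D * r) (x := D * (q * x - r))
      (by push_cast; linear_combination (q : ℚ) * hz) (mul_ne_zero (by positivity) hne)
  rw [abs_mul, Nat.abs_cast] at h
  by_contra! hlt
  have hpos := abs_pos.2 hne
  have h2 : D * |(q : ℚ) * x - r| < b * |(q : ℚ) * x - r| := by gcongr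
  nlinarith [mul_le_mul_of_nonneg_right hq' (by nlinarith : 0 ≤ b * |(q : ℚ) * x - r|)]

theorem bddAbove_partQuot (x : ℚ) :
    BddAbove {r : ℝ | ∃ q ∈ (GenContFract.of x).partDens, r = (q : ℝ)} := by
  refine ⟨x.den, ?_⟩
  rintro _ ⟨b, hb, rfl⟩
  exact_mod_cast le_of_mem_partDens x.den_pos (Rat.den_mul_eq_num x) hb

theorem le_maxPartQuot {x b : ℚ} (hb : b ∈ (GenContFract.of x).partDens) :
    (b : ℝ) ≤ maxPartQuot x :=
  le_csSup (bddAbove_partQuot x) ⟨b, hb, rfl⟩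

theorem exists_mem_partDens {x : ℚ} (hx : ∀ z : ℤ, x ≠ z) :
    ∃ b, b ∈ (GenContFract.of x).partDens := by
  have ht : ¬(GenContFract.of x).TerminatedAt 0 := fun h =>
    hx ⌊x⌋ (by simpa using of_correctness_of_terminatedAt h)
  obtain ⟨b, hb⟩ := Option.ne_none_iff_exists'.1 (mt terminatedAt_iff_partDen_none.2 ht)
  exact ⟨b, Stream'.Seq.mem_iff_exists_get?.2 ⟨0, hb.symm⟩⟩

theorem one_le_of_mem_partDens {x b : ℚ} (hb : b ∈ (GenContFract.of x).partDens) : 1 ≤ b := by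
  obtain ⟨n, hn⟩ := Stream'.Seq.mem_iff_exists_get?.1 hb
  exact of_one_le_get?_partDen hn.symm

theorem maxPartQuot_le {x : ℚ} (hx : ∀ z : ℤ, x ≠ z) {B : ℝ}
    (h : ∀ b ∈ (GenContFract.of x).partDens, (b : ℝ) ≤ B) : maxPartQuot x ≤ B := by
  obtain ⟨b, hb⟩ := exists_mem_partDens hx
  refine csSup_le ⟨b, b, hb, rfl⟩ ?_
  rintro _ ⟨b, hb, rfl⟩
  exact h b hb

theorem one_le_maxPartQuot {x : ℚ} (hx : ∀ z : ℤ, x ≠ z) : 1 ≤ maxPartQuot x := by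
  obtain ⟨b, hb⟩ := exists_mem_partDens hx
  refine le_trans ?_ (le_maxPartQuot hb)
  exact_mod_cast one_le_of_mem_partDens hb

theorem maxPartQuot_of_int (z : ℤ) : maxPartQuot z = 0 := by
  have h : {r : ℝ | ∃ q ∈ (GenContFract.of (z : ℚ)).partDens, r = (q : ℝ)} = ∅ := by
    refine Set.eq_empty_of_forall_notMem ?_
    rintro _ ⟨b, hb, rfl⟩
    obtain ⟨n, hn⟩ := Stream'.Seq.mem_iff_exists_get?.1 hb
    simp [partDens, of_s_of_int] at hn
  rw [maxPartQuot, h, Real.sSup_empty]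

theorem one_le_mul_maxPartQuot {x : ℚ} (hx : ∀ z : ℤ, x ≠ z) {q r : ℤ} (hq : 1 ≤ q)
    (hne : (q : ℚ) * x - r ≠ 0) :
    1 ≤ 8 * maxPartQuot x * ((q * |(q : ℚ) * x - r| : ℚ) : ℝ) := by
  have hK := one_le_maxPartQuot hx
  have h0 : (0 : ℚ) ≤ q * |(q : ℚ) * x - r| := by positivity
  have h := one_le_mul_approx hq hne
  set t : ℚ := q * |(q : ℚ) * x - r|
  have h0' : (0 : ℝ) ≤ t := by exact_mod_cast h0
  rcases h with h | ⟨b, hb, h⟩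
  · have h' : (1 : ℝ) ≤ 4 * t := by exact_mod_cast h
    nlinarith
  · have h' : (1 : ℝ) ≤ 4 * (b + 1) * t := by exact_mod_cast h
    have := le_maxPartQuot hb
    nlinarith

/-- Multiplying by a natural number `D` changes the largest partial quotient by a factor
at most `8 * D`, up or down. -/
theorem maxPartQuot_le_of_eq_mul_sub {x y : ℚ} {D : ℕ} (hD : 1 ≤ D) {t : ℤ} (hxy : y = D * x - t)
    (hx : ∀ z : ℤ, x ≠ z) (hy : ∀ z : ℤ, y ≠ z) :
    maxPartQuot x ≤ 8 * D * maxPartQuot y ∧ maxPartQuot y ≤ 8 * D * maxPartQuot x := by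
  have hD' : (1 : ℚ) ≤ D := by exact_mod_cast hD
  have hDabs : |(D : ℚ)| = D := Nat.abs_cast D
  have aux : ∀ (w b s : ℚ) (K : ℝ), b ∈ (GenContFract.of w).partDens → b * s ≤ 1 →
      1 ≤ 8 * K * ((D * s : ℚ) : ℝ) → 0 ≤ s → 1 ≤ K → (b : ℝ) ≤ 8 * D * K := by
    intro w b s K hb hbs h hs hK
    have hb0 : (1 : ℝ) ≤ b := by exact_mod_cast one_le_of_mem_partDens hb
    have hbs' : (b : ℝ) * s ≤ 1 := by exact_mod_cast hbs
    push_cast at h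
    calc (b : ℝ) ≤ b * (8 * K * (D * s)) := le_mul_of_one_le_right (by linarith) h
      _ = 8 * D * K * (b * s) := by ring
      _ ≤ 8 * D * K := mul_le_of_le_one_right (by positivity) hbs'
  constructor
  · refine maxPartQuot_le hx fun b hb => ?_
    obtain ⟨q, r, hq, hne, hle⟩ := exists_approx_of_mem_partDens hb
    have hq' : (1 : ℚ) ≤ q := by exact_mod_cast hq
    have heq : (q : ℚ) * y - (D * r - q * t : ℤ) = D * (q * x - r) := by
      rw [hxy]; push_cast; ring
    have h := one_le_mul_maxPartQuot hy hq (r := D * r - q * t)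
      (by rw [heq]; exact mul_ne_zero (by positivity) hne)
    rw [heq, abs_mul, hDabs, mul_left_comm] at h
    exact aux x b _ _ hb hle h (by positivity) (one_le_maxPartQuot hy)
  · refine maxPartQuot_le hy fun b hb => ?_
    obtain ⟨q, r, hq, hne, hle⟩ := exists_approx_of_mem_partDens hb
    have hq' : (1 : ℚ) ≤ q := by exact_mod_cast hq
    have heq : ((D * q : ℤ) : ℚ) * x - (q * t + r : ℤ) = q * y - r := by
      rw [hxy]; push_cast; ring
    have h := one_le_mul_maxPartQuot hx (q := D * q) (r := q * t + r)
      (one_le_mul_of_one_le_of_one_le (by exact_mod_cast hD) hq) (by rwa [heq])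
    rw [heq] at h
    push_cast at h
    rw [mul_assoc (D : ℝ)] at h
    exact aux y b _ _ hb hle (by push_cast; exact h) (by positivity) (one_le_maxPartQuot hx)

theorem xm_eq_pow_mul_sub {p : ℕ} (hp : p.Prime) (c : ℕ → ℤ) {m u : ℕ} (h : m ≤ u) :
    ∃ t : ℤ, xm p c m = (p ^ (u - m) : ℕ) * xm p c u - t := by
  have hp0 : (p : ℚ) ≠ 0 := by exact_mod_cast hp.ne_zero
  obtain ⟨d, rfl⟩ := Nat.exists_eq_add_of_le h
  refine ⟨∑ k ∈ Finset.range d, c (m + k) * p ^ k, ?_⟩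
  simp only [xm, Finset.sum_range_add, mul_add, Finset.mul_sum, Nat.add_sub_cancel_left]
  push_cast
  have h₁ : ∀ k ∈ Finset.range m, (p : ℚ) ^ d * (c k / p ^ (m + d - k)) = c k / p ^ (m - k) := by
    intro k hk
    rw [Finset.mem_range] at hk
    rw [show m + d - k = d + (m - k) by omega, pow_add]
    field_simp
  have h₂ : ∀ k ∈ Finset.range d,
      (p : ℚ) ^ d * (c (m + k) / p ^ (m + d - (m + k))) = c (m + k) * p ^ k := by
    intro k hk
    rw [Finset.mem_range] at hk
    rw [show m + d - (m + k) = d - k by omega]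
    obtain ⟨e, rfl⟩ := Nat.exists_eq_add_of_le hk.le
    rw [Nat.add_sub_cancel_left, pow_add]
    field_simp
  rw [Finset.sum_congr rfl h₁, Finset.sum_congr rfl h₂, add_sub_cancel_right]

theorem xm_ne_int_mono {p : ℕ} (hp : p.Prime) (c : ℕ → ℤ) {m u : ℕ} (h : m ≤ u)
    (hm : ∀ z : ℤ, xm p c m ≠ z) (z : ℤ) : xm p c u ≠ z := by
  intro hz
  obtain ⟨t, ht⟩ := xm_eq_pow_mul_sub hp c h
  refine hm (p ^ (u - m) * z - t) ?_
  rw [ht, hz]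
  push_cast
  rfl

theorem maxPartQuot_xm_le {p : ℕ} (hp : p.Prime) (c : ℕ → ℤ) {m : ℕ}
    (hm : ∀ z : ℤ, xm p c m ≠ z) : maxPartQuot (xm p c m) ≤ (p : ℝ) ^ m := by
  refine maxPartQuot_le hm fun b hb => ?_
  obtain ⟨t, ht⟩ := xm_eq_pow_mul_sub hp c (Nat.zero_le m)
  have h := le_of_mem_partDens (D := p ^ m) (Nat.one_le_pow _ _ hp.pos) (z := t)
    (by simp [xm] at ht ⊢; linarith) hb
  exact_mod_cast h

theorem natCast_mul_etaSeq (p : ℕ) (c : ℕ → ℤ) {m : ℕ} (hm : m ≠ 0) :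
    m * etaSeq p c m = Real.logb p (maxPartQuot (xm p c m)) := by
  have : (m : ℝ) ≠ 0 := by exact_mod_cast hm
  rw [etaSeq]
  field_simp

theorem logb_le_of_le_mul {p d : ℕ} (hp : p.Prime) {K L : ℝ} (hK : 1 ≤ K) (hL : 1 ≤ L)
    (h : K ≤ 8 * (p ^ d : ℕ) * L) : Real.logb p K ≤ Real.logb p 8 + d + Real.logb p L := by
  have hp1 : (1 : ℝ) < p := by exact_mod_cast hp.one_lt
  have hp0 : (0 : ℝ) < p := by linarith
  have h' := Real.logb_le_logb_of_le hp1 (by linarith) h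
  rwa [Real.logb_mul (by simp [hp.ne_zero]) (by linarith), Real.logb_mul (by norm_num)
    (by simp [hp.ne_zero]), Nat.cast_pow, Real.logb_pow, Real.logb_self_eq_one hp1, mul_one] at h'

theorem eta_upper_bound (p : ℕ) (hp : p.Prime) (c : ℕ → ℤ)
    (hc : ∃ B : ℝ, ∀ k, |(c k : ℝ)| ≤ B) :
    ∀ ε : ℝ, 0 < ε → ∃ M : ℕ, ∀ m u n : ℕ, M ≤ m → m ≤ u → u ≤ n →
      etaSeq p c u ≤
        ((n : ℝ) * (1 + etaSeq p c n) - (m : ℝ) * (1 - etaSeq p c m)) /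
          ((n : ℝ) * (1 + etaSeq p c n) + (m : ℝ) * (1 - etaSeq p c m)) + ε := by
  intro ε hε
  have hp1 : (1 : ℝ) < p := by exact_mod_cast hp.one_lt
  by_cases hint : ∀ m, ∃ z : ℤ, xm p c m = z
  · have heta : ∀ m, etaSeq p c m = 0 := by
      intro m
      obtain ⟨z, hz⟩ := hint m
      rw [etaSeq, hz, maxPartQuot_of_int, Real.logb_zero, zero_div]
    refine ⟨0, fun m u n _ hmu hun => ?_⟩
    have hmn : (m : ℝ) ≤ n := by exact_mod_cast hmu.trans hun
    rw [heta, heta, heta]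
    have : 0 ≤ ((n : ℝ) * (1 + 0) - m * (1 - 0)) / (n * (1 + 0) + m * (1 - 0)) :=
      div_nonneg (by linarith) (by positivity)
    linarith
  · push Not at hint
    obtain ⟨M₀, hM₀⟩ := hint
    set C := Real.logb p 8
    have hC : 0 ≤ C := Real.logb_nonneg hp1 (by norm_num)
    obtain ⟨M₁, hM₁⟩ := exists_nat_gt (2 * C / ε)
    refine ⟨max (M₀ + 1) M₁, fun m u n hm hmu hun => ?_⟩
    have hm₀ : M₀ + 1 ≤ m := (le_max_left _ _).trans hm
    have hm₁ : M₁ ≤ m := (le_max_right _ _).trans hm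
    have hne : ∀ k, m ≤ k → ∀ z : ℤ, xm p c k ≠ z :=
      fun k hk => xm_ne_int_mono hp c (by omega) hM₀
    have hlow : ∀ k, m ≤ k → 0 ≤ k * etaSeq p c k := by
      intro k hk
      rw [natCast_mul_etaSeq p c (by omega)]
      exact Real.logb_nonneg hp1 (one_le_maxPartQuot (hne k hk))
    have hup : ∀ k, m ≤ k → k * etaSeq p c k ≤ k := by
      intro k hk
      have h := one_le_maxPartQuot (hne k hk)
      rw [natCast_mul_etaSeq p c (by omega), Real.logb_le_iff_le_rpow hp1 (by linarith),
        Real.rpow_natCast]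
      exact maxPartQuot_xm_le hp c (hne k hk)
    have hmu' : u * etaSeq p c u ≤ C + (u - m) + m * etaSeq p c m := by
      obtain ⟨t, ht⟩ := xm_eq_pow_mul_sub hp c hmu
      rw [natCast_mul_etaSeq p c (by omega), natCast_mul_etaSeq p c (by omega), ← Nat.cast_sub hmu]
      exact logb_le_of_le_mul hp (one_le_maxPartQuot (hne u hmu))
        (one_le_maxPartQuot (hne m le_rfl))
        (maxPartQuot_le_of_eq_mul_sub (Nat.one_le_pow _ _ hp.pos) ht (hne u hmu) (hne m le_rfl)).1
    have hun' : u * etaSeq p c u ≤ C + (n - u) + n * etaSeq p c n := by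
      obtain ⟨t, ht⟩ := xm_eq_pow_mul_sub hp c hun
      have hmn := hmu.trans hun
      rw [natCast_mul_etaSeq p c (by omega), natCast_mul_etaSeq p c (by omega), ← Nat.cast_sub hun]
      exact logb_le_of_le_mul hp (one_le_maxPartQuot (hne u hmu))
        (one_le_maxPartQuot (hne n hmn))
        (maxPartQuot_le_of_eq_mul_sub (Nat.one_le_pow _ _ hp.pos) ht (hne n hmn) (hne u hmu)).2
    have hu0 : (0 : ℝ) < u := by exact_mod_cast (by omega : 0 < u)
    have hunR : (u : ℝ) ≤ n := by exact_mod_cast hun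
    have hCu : 2 * C ≤ ε * u := by
      have : (M₁ : ℝ) ≤ u := by exact_mod_cast hm₁.trans hmu
      rw [div_lt_iff₀ hε] at hM₁
      nlinarith
    have h0 := nonneg_of_mul_nonneg_right (hlow u hmu) hu0
    have h1 : etaSeq p c u ≤ 1 := by
      have := hup u hmu
      nlinarith
    have hn0 := hlow n (hmu.trans hun)
    have hm1 := hup m le_rfl
    set η := etaSeq p c u
    set N := (n : ℝ) * (1 + etaSeq p c n) with hN
    set L := (m : ℝ) * (1 - etaSeq p c m) with hL
    have hNC : u * (1 + η) - C ≤ N := by linarith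
    have hLC : L ≤ u * (1 - η) + C := by linarith
    have hNL : u ≤ N + L := by linarith
    rw [← sub_le_iff_le_add, le_div_iff₀ (by linarith)]
    have e1 : L * (1 + η) ≤ (u * (1 - η) + C) * (1 + η) := by gcongr
    have e2 : (u * (1 + η) - C) * (1 - η) ≤ N * (1 - η) :=
      mul_le_mul_of_nonneg_right hNC (by linarith)
    have e3 : ε * u ≤ ε * (N + L) := by gcongr
    linarith
end

section
/- Let p be a prime number, c = (c_k)_{k≥0} a bounded sequence of integers, and ξ = Σ_{k≥0} c_k p^k the corresponding p-adic number, assumed irrational. If there exist positive real numbers c₁ and δ with δ < 1 such that for every m ≥ 1 all the partial quotients of x_m are less than c₁ p^{δm}, then there exists c₂ > 0 such that |bξ − a|_p > c₂ |ab|^{−1/(1−δ)} for all nonzero integers a, b. -/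
open Filter Topology in
/-- Truncating a `p`-adic series `∑ c_k p^k` with integer coefficients after `m` terms changes it
by at most `p^{-m}`. -/
lemma Padic.norm_tsum_sub_sum_range_le (p : ℕ) [Fact p.Prime] (c : ℕ → ℤ) (m : ℕ) :
    ‖(∑' k : ℕ, (c k : ℚ_[p]) * (p : ℚ_[p]) ^ k) -
      ((∑ k ∈ Finset.range m, c k * (p : ℤ) ^ k : ℤ) : ℚ_[p])‖ ≤ (p : ℝ) ^ (-(m : ℤ)) := by
  have hp : 1 < (p : ℝ) := by exact_mod_cast (Fact.out : p.Prime).one_lt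
  have hterm (k : ℕ) : ‖(c k : ℚ_[p]) * (p : ℚ_[p]) ^ k‖ ≤ ((p : ℝ)⁻¹) ^ k := by
    rw [norm_mul, norm_pow, Padic.norm_p]
    exact mul_le_of_le_one_left (by positivity) (Padic.norm_int_le_one _)
  have hsum : Summable fun k : ℕ ↦ (c k : ℚ_[p]) * (p : ℚ_[p]) ^ k :=
    Summable.of_norm_bounded
      (summable_geometric_of_lt_one (by positivity) (inv_lt_one_of_one_lt₀ hp)) hterm
  have hlim := (hsum.hasSum.tendsto_sum_nat.sub_const
    ((∑ k ∈ Finset.range m, c k * (p : ℤ) ^ k : ℤ) : ℚ_[p])).norm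
  refine le_of_tendsto hlim ?_
  filter_upwards [eventually_ge_atTop m] with n hn
  have hcast : (∑ k ∈ Finset.range n, (c k : ℚ_[p]) * (p : ℚ_[p]) ^ k) -
      ((∑ k ∈ Finset.range m, c k * (p : ℤ) ^ k : ℤ) : ℚ_[p]) =
      ((∑ k ∈ Finset.Ico m n, c k * (p : ℤ) ^ k : ℤ) : ℚ_[p]) := by
    rw [Finset.sum_Ico_eq_sub _ hn]
    push_cast
    ring
  rw [hcast, Padic.norm_int_le_pow_iff_dvd]
  refine Finset.dvd_sum fun k hk ↦ Dvd.dvd.mul_left ?_ _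
  exact pow_dvd_pow _ (Finset.mem_Ico.mp hk).1

/-- Apart from the integer part, the continued fraction of `v` starts with `⌊(fract v)⁻¹⌋` and
continues with the partial denominators of `(fract v)⁻¹`. -/
lemma GenContFract.partDens_of_eq_cons {K : Type*} [Field K] [LinearOrder K]
    [IsStrictOrderedRing K] [FloorRing K] {v : K} (h : Int.fract v ≠ 0) :
    (GenContFract.of v).partDens =
      Stream'.Seq.cons (⌊(Int.fract v)⁻¹⌋ : K) (GenContFract.of (Int.fract v)⁻¹).partDens := by
  rw [GenContFract.partDens, Stream'.Seq.head_eq_some (GenContFract.of_s_head h),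
    GenContFract.of_s_tail, Stream'.Seq.map_cons]
  rfl

/-- Case of a fraction `y / b` above `t = 1 / (α + f)`, where `α` is the next partial quotient. -/
lemma one_le_mul_sub_mul_of_lt {t f M : ℝ} {α y b : ℤ} (hα : 1 ≤ α) (hαM : (α : ℝ) ≤ M)
    (hf : 0 ≤ f) (hf1 : f < 1) (ht : t * (α + f) = 1) (hb : 0 < b) (hlt : (b : ℝ) * t < y)
    (hfM : 0 < f → 1 < f * (M + 1))
    (ih : 0 < f → ∀ r : ℤ, 0 < r → (r : ℝ) * f⁻¹ ≠ y →
      1 ≤ r * |(r : ℝ) * f⁻¹ - y| * (M + 2)) :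
    1 ≤ b * (y - b * t) * (M + 2) := by
  have hα' : (1 : ℝ) ≤ α := by exact_mod_cast hα
  have hb' : (1 : ℝ) ≤ b := by exact_mod_cast hb
  have hαf : 0 < α + f := by linarith
  have ht0 : 0 < t := pos_of_mul_pos_left (by rw [ht]; exact one_pos) hαf.le
  have htM : 1 ≤ t * (M + 2) := by
    rw [← ht]; gcongr; linarith
  have hy' : (0 : ℝ) < y := lt_trans (by positivity) hlt
  have hy : (1 : ℝ) ≤ y := by
    have : 0 < y := by exact_mod_cast hy'
    exact_mod_cast this
  have hkey : y - b * t = t * (y * (α + f) - b) := by linear_combination (-(y : ℝ)) * ht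
  have hpos : 0 < y * (α + f) - b :=
    pos_of_mul_pos_right (by rw [← hkey]; linarith) ht0.le
  rw [hkey]
  rcases lt_trichotomy (b - α * y) 0 with hr | hr | hr
  · have hr' : (b : ℝ) + 1 ≤ α * y := by
      have : b + 1 ≤ α * y := by linarith
      exact_mod_cast this
    have h1 : 1 ≤ y * (α + f) - b := by nlinarith
    have h2 : 1 ≤ b * (y * (α + f) - b) := one_le_mul_of_one_le_of_one_le hb' h1
    calc (1 : ℝ) ≤ t * (M + 2) * 1 := by linarith
      _ ≤ t * (M + 2) * (b * (y * (α + f) - b)) := by gcongr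
      _ = _ := by ring
  · have hr' : (b : ℝ) = α * y := by
      have : b = α * y := by linarith
      exact_mod_cast this
    rw [hr'] at hpos ⊢
    have hf0 : 0 < f := by
      by_contra h
      nlinarith
    have h1 := hfM hf0
    have h2 : α + f ≤ α * f * (M + 2) := by nlinarith
    have h3 : 1 ≤ t * (α * f * (M + 2)) := by rw [← ht]; gcongr
    calc (1 : ℝ) ≤ t * (α * f * (M + 2)) * 1 := by linarith
      _ ≤ t * (α * f * (M + 2)) * (y * y) := by gcongr; nlinarith
      _ = _ := by ring
  · set r : ℤ := b - α * y with hrdef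
    have hr' : (b : ℝ) = α * y + r := by rw [hrdef]; push_cast; ring
    have hr0 : (0 : ℝ) < r := by exact_mod_cast hr
    have hyf : (r : ℝ) < y * f := by rw [hr'] at hpos; linarith
    have hf0 : 0 < f := pos_of_mul_pos_right (hr0.trans hyf) hy'.le
    have hlt' : (r : ℝ) * f⁻¹ < y := by rwa [← div_eq_mul_inv, div_lt_iff₀ hf0]
    have h1 := ih hf0 r hr hlt'.ne
    rw [abs_of_neg (by linarith)] at h1
    have h2 : (r : ℝ) ≤ b * t * f := by
      have : (r : ℝ) * (α + f) ≤ b * f := by rw [hr']; nlinarith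
      calc (r : ℝ) = r * (α + f) * t := by linear_combination (-(r : ℝ)) * ht
        _ ≤ b * f * t := by gcongr
        _ = _ := by ring
    calc (1 : ℝ) ≤ r * -(r * f⁻¹ - y) * (M + 2) := h1
      _ ≤ b * t * f * -(r * f⁻¹ - y) * (M + 2) := by
        gcongr <;> linarith
      _ = _ := by
        rw [hr']
        field_simp
        ring

/-- A rational number whose partial quotients are at most `M` is approximated by a different
fraction `y / b`, `b > 0`, with error at least `1 / ((M + 2) b²)`. -/
lemma Rat.one_le_mul_abs_mul_sub_of_partDens_le {M : ℝ} (hM : 0 ≤ M) (x : ℚ)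
    (hx : ∀ q ∈ (GenContFract.of x).partDens, (q : ℝ) ≤ M) (b y : ℤ) (hb : 0 < b)
    (hne : (b : ℝ) * x ≠ y) : 1 ≤ b * |(b : ℝ) * x - y| * (M + 2) := by
  induction hn : (Int.fract x).num.toNat using Nat.strong_induction_on generalizing x b y with
  | _ n ih =>
  have hb' : (1 : ℝ) ≤ b := by exact_mod_cast hb
  by_cases h0 : Int.fract x = 0
  · have hxz : (x : ℝ) = (⌊x⌋ : ℤ) := by
      have h := Int.floor_add_fract x
      rw [h0, add_zero] at h
      exact_mod_cast h.symm
    rw [hxz] at hne ⊢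
    have h1 : (1 : ℝ) ≤ |(b : ℝ) * (⌊x⌋ : ℤ) - y| := by
      have : 1 ≤ |b * ⌊x⌋ - y| := Int.one_le_abs (sub_ne_zero.mpr (by exact_mod_cast hne))
      exact_mod_cast this
    have := one_le_mul_of_one_le_of_one_le hb' h1
    nlinarith
  have descend : ∀ v : ℚ, (∀ q ∈ (GenContFract.of v).partDens, (q : ℝ) ≤ M) →
      0 < Int.fract v → ((⌊(Int.fract v)⁻¹⌋ : ℤ) : ℝ) ≤ M ∧
        (∀ q ∈ (GenContFract.of (Int.fract v)⁻¹).partDens, (q : ℝ) ≤ M) ∧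
        (Int.fract (Int.fract v)⁻¹).num.toNat < (Int.fract v).num.toNat := by
    intro v hv hv0
    rw [GenContFract.partDens_of_eq_cons hv0.ne'] at hv
    refine ⟨by simpa using hv _ (Stream'.Seq.mem_cons _ _),
      fun q hq ↦ hv q (Stream'.Seq.mem_cons_of_mem _ hq), ?_⟩
    have := Rat.fract_inv_num_lt_num_of_pos hv0
    have := Rat.num_pos.mpr hv0
    omega
  have hpos : 0 < Int.fract x := lt_of_le_of_ne (Int.fract_nonneg x) (Ne.symm h0)
  obtain ⟨hαM, hx₁, hlt₁⟩ := descend x hx hpos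
  set t : ℚ := Int.fract x with htdef
  set α : ℤ := ⌊t⁻¹⌋ with hαdef
  set f : ℚ := Int.fract t⁻¹ with hfdef
  have ht1 : t < 1 := Int.fract_lt_one x
  have hα : 1 ≤ α := Int.le_floor.mpr (by exact_mod_cast (one_lt_inv₀ hpos).mpr ht1 |>.le)
  have hinv : t⁻¹ = α + f := (Int.floor_add_fract _).symm
  have ht : (t : ℝ) * (α + f) = 1 := by
    have : t * (α + f) = 1 := by rw [← hinv]; exact mul_inv_cancel₀ hpos.ne'
    exact_mod_cast this
  have hf : (0 : ℝ) ≤ f := by exact_mod_cast Int.fract_nonneg t⁻¹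
  have hf1 : (f : ℝ) < 1 := by exact_mod_cast Int.fract_lt_one t⁻¹
  have htpos : (0 : ℝ) < t := by exact_mod_cast hpos
  have htM : 1 ≤ (t : ℝ) * (M + 2) := by
    rw [← ht]; gcongr; linarith
  set z : ℤ := y - b * ⌊x⌋ with hzdef
  have hbx : (b : ℝ) * x - y = b * t - z := by
    have h : (x : ℝ) = (⌊x⌋ : ℤ) + t := by
      have := (Int.floor_add_fract x).symm
      exact_mod_cast this
    rw [h, hzdef]; push_cast; ring
  have hne' : (b : ℝ) * t - z ≠ 0 := by rw [← hbx]; exact sub_ne_zero.mpr hne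
  rw [hbx]
  rcases lt_or_gt_of_ne hne' with hneg | hgt
  · rw [abs_of_neg hneg, neg_sub]
    refine one_le_mul_sub_mul_of_lt hα hαM hf hf1 ht hb (by linarith) ?_ ?_
    · intro hf0
      have hf0' : 0 < f := by exact_mod_cast hf0
      have h1 := (descend t⁻¹ hx₁ hf0').1
      have h2 : (f : ℝ)⁻¹ < (⌊f⁻¹⌋ : ℤ) + 1 := by exact_mod_cast Int.lt_floor_add_one f⁻¹
      calc (1 : ℝ) = f * (f : ℝ)⁻¹ := (mul_inv_cancel₀ hf0.ne').symm
        _ < f * (M + 1) := by gcongr; linarith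
    · intro hf0 r hr hrne
      have hf0' : 0 < f := by exact_mod_cast hf0
      obtain ⟨-, hx₂, hlt₂⟩ := descend t⁻¹ hx₁ hf0'
      have := ih _ (hn ▸ hlt₂.trans hlt₁) f⁻¹ hx₂ r z hr (by simpa using hrne) rfl
      simpa using this
  · rw [abs_of_pos hgt]
    rcases le_or_gt z 0 with hz | hz
    · have hz' : (z : ℝ) ≤ 0 := by exact_mod_cast hz
      have h1 : (t : ℝ) ≤ b * (b * t - z) := by
        have : (t : ℝ) ≤ b * t := le_mul_of_one_le_left htpos.le hb'
        nlinarith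
      calc (1 : ℝ) ≤ t * (M + 2) := htM
        _ ≤ _ := by gcongr
    · have hz' : (0 : ℝ) < z := by exact_mod_cast hz
      have hkey : (z : ℝ) * (α + f) - b = -((b * t - z) * (α + f)) := by
        linear_combination (b : ℝ) * ht
      have hαf : (0 : ℝ) < α + f := by
        have : (1 : ℝ) ≤ α := by exact_mod_cast hα
        linarith
      have hinv' : ((t⁻¹ : ℚ) : ℝ) = α + f := by exact_mod_cast hinv
      have h1 := ih _ (hn ▸ hlt₁) t⁻¹ hx₁ z b hz (by
        rw [hinv']
        refine sub_ne_zero.mp ?_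
        rw [hkey]
        exact (neg_lt_zero.mpr (mul_pos hgt hαf)).ne) rfl
      rw [hinv', hkey, abs_neg, abs_of_pos (mul_pos hgt hαf)] at h1
      calc (1 : ℝ) ≤ z * ((b * t - z) * (α + f)) * (M + 2) := h1
        _ = z * (α + f) * (b * t - z) * (M + 2) := by ring
        _ ≤ b * (b * t - z) * (M + 2) := by
          gcongr
          nlinarith [mul_pos hgt hαf]

/-- The version of `Rat.one_le_mul_abs_mul_sub_of_partDens_le` without a sign condition on `b`. -/
lemma Rat.one_le_abs_mul_abs_mul_sub_of_partDens_le {M : ℝ} (hM : 0 ≤ M) (x : ℚ)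
    (hx : ∀ q ∈ (GenContFract.of x).partDens, (q : ℝ) ≤ M) (b y : ℤ) (hb : b ≠ 0)
    (hne : (b : ℝ) * x ≠ y) : 1 ≤ |(b : ℝ)| * |(b : ℝ) * x - y| * (M + 2) := by
  rcases lt_or_gt_of_ne hb with h | h
  · have := Rat.one_le_mul_abs_mul_sub_of_partDens_le hM x hx (-b) (-y) (by omega)
      (by push_cast; contrapose! hne; linarith)
    push_cast at this
    rwa [show -(b : ℝ) * x - -y = -(b * x - y) by ring, abs_neg,
      ← abs_of_neg (show (b : ℝ) < 0 by exact_mod_cast h)] at this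
  · rw [abs_of_pos (show (0 : ℝ) < b by exact_mod_cast h)]
    exact Rat.one_le_mul_abs_mul_sub_of_partDens_le hM x hx b y h hne

/-- Clearing denominators in `x_m` gives the `m`-th partial sum of `∑ c_k p^k`. -/
lemma xm_mul_pow (p : ℕ) (hp : p ≠ 0) (c : ℕ → ℤ) (m : ℕ) :
    xm p c m * (p : ℚ) ^ m = ((∑ k ∈ Finset.range m, c k * (p : ℤ) ^ k : ℤ) : ℚ) := by
  have hp' : (p : ℚ) ≠ 0 := by exact_mod_cast hp
  rw [xm, Finset.sum_mul]
  push_cast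
  refine Finset.sum_congr rfl fun k hk ↦ ?_
  rw [div_mul_eq_mul_div, div_eq_iff (pow_ne_zero _ hp'), mul_assoc, ← pow_add,
    Nat.add_sub_cancel' (Finset.mem_range.mp hk).le]

/-- If `p^m` divides `b ξ - a`, then `p^m ≤ |ab| (M + 2)` whenever the partial quotients of `x_m`
are at most `M`. -/
lemma pow_le_mul_of_norm_le (p : ℕ) [Fact p.Prime] (c : ℕ → ℤ) (m : ℕ) {M : ℝ} (hM : 0 ≤ M)
    (hx : ∀ q ∈ (GenContFract.of (xm p c m)).partDens, (q : ℝ) ≤ M) {a b : ℤ} (ha : a ≠ 0)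
    (hb : b ≠ 0)
    (hab : ‖(b : ℚ_[p]) * (∑' k : ℕ, (c k : ℚ_[p]) * (p : ℚ_[p]) ^ k) - a‖ ≤
      (p : ℝ) ^ (-(m : ℤ))) :
    (p : ℝ) ^ m ≤ ((|a * b| : ℤ) : ℝ) * (M + 2) := by
  have hp0 : p ≠ 0 := (Fact.out : p.Prime).ne_zero
  have hpm : (0 : ℝ) < (p : ℝ) ^ m := by positivity
  set N : ℤ := ∑ k ∈ Finset.range m, c k * (p : ℤ) ^ k with hN
  obtain ⟨y, hy⟩ : (p : ℤ) ^ m ∣ b * N - a := by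
    have htrunc := Padic.norm_tsum_sub_sum_range_le p c m
    rw [← hN] at htrunc
    rw [← Padic.norm_int_le_pow_iff_dvd]
    set ξ : ℚ_[p] := ∑' k : ℕ, (c k : ℚ_[p]) * (p : ℚ_[p]) ^ k
    have hsplit : ((b * N - a : ℤ) : ℚ_[p]) = (b * ξ - a) + -b * (ξ - N) := by
      push_cast
      ring
    rw [hsplit]
    refine (Padic.nonarchimedean _ _).trans (max_le hab ?_)
    rw [norm_mul, norm_neg]
    exact (mul_le_of_le_one_left (norm_nonneg _) (Padic.norm_int_le_one b)).trans htrunc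
  have hxN : (xm p c m : ℝ) * (p : ℝ) ^ m = N := by exact_mod_cast xm_mul_pow p hp0 c m
  have hy' : (b : ℝ) * N - a = (p : ℝ) ^ m * y := by exact_mod_cast hy
  have hdiff : ((b : ℝ) * xm p c m - y) * (p : ℝ) ^ m = a := by
    linear_combination (b : ℝ) * hxN + hy'
  have ha' : (a : ℝ) ≠ 0 := by exact_mod_cast ha
  have h1 := Rat.one_le_abs_mul_abs_mul_sub_of_partDens_le hM _ hx b y hb (by
    intro h
    rw [h, sub_self, zero_mul] at hdiff
    exact ha' hdiff.symm)
  have habs : |(b : ℝ) * xm p c m - y| * (p : ℝ) ^ m = |(a : ℝ)| := by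
    rw [← hdiff, abs_mul, abs_of_pos hpm]
  push_cast
  rw [abs_mul, ← habs]
  calc (p : ℝ) ^ m = 1 * (p : ℝ) ^ m := (one_mul _).symm
    _ ≤ |(b : ℝ)| * |(b : ℝ) * xm p c m - y| * (M + 2) * (p : ℝ) ^ m := by gcongr
    _ = _ := by ring

theorem small_partial_quotients_imply_lower_bound (p : ℕ) [Fact p.Prime] (c : ℕ → ℤ)
    (hc : ∃ B : ℝ, ∀ k, |(c k : ℝ)| ≤ B)
    (ξ : ℚ_[p]) (hξ : ξ = ∑' k : ℕ, (c k : ℚ_[p]) * (p : ℚ_[p]) ^ k)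
    (hirr : ∀ q : ℚ, ξ ≠ (q : ℚ_[p]))
    (c₁ δ : ℝ) (hc₁ : 0 < c₁) (hδ : 0 < δ) (hδ1 : δ < 1)
    (hsmall : ∀ m : ℕ, 1 ≤ m →
      ∀ q ∈ (GenContFract.of (xm p c m)).partDens, (q : ℝ) < c₁ * (p : ℝ) ^ (δ * m)) :
    ∃ c₂ : ℝ, 0 < c₂ ∧ ∀ a b : ℤ, a ≠ 0 → b ≠ 0 →
      c₂ * ((|a * b| : ℤ) : ℝ) ^ (-(1 / (1 - δ))) < ‖(b : ℚ_[p]) * ξ - (a : ℚ_[p])‖ := by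
  have hp1 : (1 : ℝ) < p := by exact_mod_cast (Fact.out : p.Prime).one_lt
  have hp0 : (0 : ℝ) < p := by linarith
  have hδ' : 0 < 1 - δ := by linarith
  have hC : 0 < c₁ + 2 := by linarith
  refine ⟨(c₁ + 2) ^ (-(1 / (1 - δ))) / 2, by positivity, fun a b ha hb ↦ ?_⟩
  have hD : (1 : ℝ) ≤ ((|a * b| : ℤ) : ℝ) := by
    exact_mod_cast Int.one_le_abs (mul_ne_zero ha hb)
  set D : ℝ := ((|a * b| : ℤ) : ℝ) with hDdef
  have hCD : 0 < ((c₁ + 2) * D) ^ (-(1 / (1 - δ))) := by positivity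
  suffices h : ((c₁ + 2) * D) ^ (-(1 / (1 - δ))) ≤ ‖(b : ℚ_[p]) * ξ - (a : ℚ_[p])‖ by
    rw [div_mul_eq_mul_div, ← Real.mul_rpow hC.le (by linarith)]
    linarith
  have hne : (b : ℚ_[p]) * ξ - a ≠ 0 := by
    intro h
    have hb' : (b : ℚ_[p]) ≠ 0 := by exact_mod_cast hb
    apply hirr (a / b)
    push_cast
    rw [eq_div_iff hb']
    linear_combination h
  have hnorm := Padic.norm_eq_zpow_neg_valuation hne
  set v : ℤ := ((b : ℚ_[p]) * ξ - a).valuation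
  rcases le_or_gt v 0 with hv | hv
  · calc ((c₁ + 2) * D) ^ (-(1 / (1 - δ))) ≤ 1 :=
        Real.rpow_le_one_of_one_le_of_nonpos (by nlinarith)
          (neg_nonpos.mpr (one_div_nonneg.mpr hδ'.le))
      _ ≤ _ := by rw [hnorm]; exact one_le_zpow₀ hp1.le (by omega)
  · obtain ⟨m, hm⟩ := Int.eq_ofNat_of_zero_le hv.le
    have hm1 : 1 ≤ m := by omega
    rw [hm] at hnorm
    have hbound := pow_le_mul_of_norm_le p c m (M := c₁ * (p : ℝ) ^ (δ * m)) (by positivity)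
      (fun q hq ↦ (hsmall m hm1 q hq).le) ha hb (by rw [← hξ]; exact hnorm.le)
    rw [← hDdef] at hbound
    have hpow1 : 1 ≤ (p : ℝ) ^ (δ * m) := Real.one_le_rpow hp1.le (by positivity)
    have hpow : (p : ℝ) ^ ((m : ℝ) * (1 - δ)) ≤ (c₁ + 2) * D := by
      rw [show (m : ℝ) * (1 - δ) = m - δ * m by ring, Real.rpow_sub hp0, Real.rpow_natCast,
        div_le_iff₀ (by positivity)]
      calc (p : ℝ) ^ m ≤ D * (c₁ * (p : ℝ) ^ (δ * m) + 2) := hbound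
        _ ≤ D * (c₁ * (p : ℝ) ^ (δ * m) + 2 * (p : ℝ) ^ (δ * m)) := by gcongr; linarith
        _ = _ := by ring
    calc ((c₁ + 2) * D) ^ (-(1 / (1 - δ))) ≤
          ((p : ℝ) ^ ((m : ℝ) * (1 - δ))) ^ (-(1 / (1 - δ))) :=
        Real.rpow_le_rpow_of_nonpos (by positivity) hpow
          (neg_nonpos.mpr (one_div_nonneg.mpr hδ'.le))
      _ = (p : ℝ) ^ (-(m : ℝ)) := by
        rw [← Real.rpow_mul hp0.le]
        congr 1
        field_simp
      _ = _ := by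
        rw [hnorm, ← Real.rpow_intCast]
        simp
end

section
/- Let p be a prime number. There exist a positive real number c and an integer K such that for every k ≥ K, at most one partial quotient of the continued fraction expansion of the rational number z_{3·2^k} exceeds c p^{2^{k−1}} (namely the unique largest partial quotient, which is of order p^{2^k}). -/
open Finset
open GenContFract (of)

namespace GenContFract

theorem exists_int_contsAux (z : ℚ) (n : ℕ) :
    ∃ a b : ℤ, (of z).contsAux n = ⟨(a : ℚ), (b : ℚ)⟩ := by
  induction n using Nat.strong_induction_on with
  | _ n ih =>
    match n with
    | 0 => exact ⟨1, 0, by simp [contsAux]⟩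
    | 1 => exact ⟨⌊z⌋, 1, by simp [contsAux, of_h_eq_floor]⟩
    | n + 2 =>
      obtain ⟨a, b, hab⟩ := ih n (by omega)
      obtain ⟨a', b', hab'⟩ := ih (n + 1) (by omega)
      cases hs : (of z).s.get? n with
      | none =>
        exact ⟨a', b', by rw [← hab']; simp [contsAux, hs]⟩
      | some gp =>
        obtain ⟨h1, d, hd⟩ := of_partNum_eq_one_and_exists_int_partDen_eq hs
        refine ⟨d * a' + a, d * b' + b, ?_⟩
        rw [contsAux_recurrence hs hab hab', h1, hd]
        simp

theorem one_le_dens (z : ℚ) (n : ℕ) : 1 ≤ (of z).dens n := by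
  induction n with
  | zero => simp
  | succ n ih => exact ih.trans of_den_mono

/-- Integrality, coprimality, growth and approximation quality of the convergent preceding a given
partial quotient `q`. -/
theorem exists_int_convergent (z : ℚ) {n : ℕ} {q : ℚ} (hq : (of z).partDens.get? n = some q) :
    ∃ a b b' : ℤ, (of z).dens n = b ∧ (of z).dens (n + 1) = b' ∧ IsCoprime a b ∧ 1 ≤ b ∧
      q * b ≤ b' ∧ z * b ≠ a ∧ |z * b - a| * b' ≤ 1 := by
  obtain ⟨a, b, hab⟩ := exists_int_contsAux z (n + 1)
  obtain ⟨a', b', hab'⟩ := exists_int_contsAux z (n + 2)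
  have hnum : (of z).nums n = a := by
    rw [num_eq_conts_a, nth_cont_eq_succ_nth_contAux, hab]
  have hden : (of z).dens n = b := by
    rw [den_eq_conts_b, nth_cont_eq_succ_nth_contAux, hab]
  have hnum' : (of z).nums (n + 1) = a' := by
    rw [num_eq_conts_a, nth_cont_eq_succ_nth_contAux, hab']
  have hden' : (of z).dens (n + 1) = b' := by
    rw [den_eq_conts_b, nth_cont_eq_succ_nth_contAux, hab']
  have hterm : ¬ (of z).TerminatedAt n := by
    rw [terminatedAt_iff_partDen_none, hq]; simp
  have hb : (1 : ℚ) ≤ b := hden ▸ one_le_dens z n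
  have hb' : (1 : ℚ) ≤ b' := hden' ▸ one_le_dens z (n + 1)
  have hbpos : (0 : ℚ) < b := by linarith
  have hconv : (of z).convs n = a / b := by rw [conv_eq_num_div_den, hnum, hden]
  refine ⟨a, b, b', hden, hden', ?_, by exact_mod_cast hb, ?_, ?_, ?_⟩
  · have hdet := SimpContFract.determinant (s := SimpContFract.of z) (n := n) hterm
    change (of z).nums n * (of z).dens (n + 1) - (of z).dens n * (of z).nums (n + 1) = _ at hdet
    rw [hnum, hnum', hden, hden'] at hdet
    have hdet' : a * b' - b * a' = (-1) ^ (n + 1) := by exact_mod_cast hdet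
    have hsq : ((-1 : ℤ) ^ (n + 1)) * (-1) ^ (n + 1) = 1 := by
      rw [← mul_pow]; simp
    refine ⟨(-1) ^ (n + 1) * b', -((-1) ^ (n + 1) * a'), ?_⟩
    linear_combination (-1) ^ (n + 1) * hdet' + hsq
  · rw [← hden, ← hden']; exact le_of_succ_get?_den hq
  · intro h
    obtain ⟨gp, hs, -⟩ := exists_s_b_of_partDen hq
    obtain ⟨ifp', hst', -⟩ := IntFractPair.exists_succ_get?_stream_of_gcf_of_get?_eq_some hs
    obtain ⟨ifp, hst, hfr, -⟩ := IntFractPair.succ_nth_stream_eq_some_iff.1 hst'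
    have key := sub_convs_eq hst
    simp only [hfr, if_false] at key
    rw [hconv, ← h, mul_div_assoc, div_self hbpos.ne', mul_one, sub_self, hab] at key
    have h0 : 0 ≤ ((of z).contsAux n).b := zero_le_of_contsAux_b
    have hfpos : 0 < ifp.fr := lt_of_le_of_ne (IntFractPair.nth_stream_fr_nonneg hst) (Ne.symm hfr)
    have : (b : ℚ) * (ifp.fr⁻¹ * b + ((of z).contsAux n).b) ≠ 0 := by positivity
    exact (div_ne_zero (pow_ne_zero _ (by norm_num)) this) key.symm
  · have key := abs_sub_convs_le hterm
    rw [hconv, hden, hden'] at key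
    have e : z * b - a = (z - a / b) * b := by field_simp
    rw [e, abs_mul, abs_of_pos hbpos]
    rw [le_div_iff₀ (by positivity)] at key
    linarith

end GenContFract

/-- Either an approximation `h / x` of `A / N` of small denominator coincides with the convergent
`a / b`, or the denominator of that convergent is large. -/
theorem le_denom_or_eq_convergent {N A a b b' x h y : ℤ} (hab : IsCoprime a b) (hb : 1 ≤ b)
    (hs : |A * b - a * N| * b' ≤ N) (hx : 0 < x)
    (hxb : 2 * x ≤ b') (hy : x * A - h * N = y) (hN : 0 < N) :
    N ≤ 2 * |y| * b ∨
      (x * a = h * b ∧ ∃ α : ℤ, 0 < α ∧ x = α * b ∧ α ∣ y ∧ |y| * b' ≤ α * N) := by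
  by_cases hD : x * a = h * b
  · right
    refine ⟨hD, ?_⟩
    obtain ⟨α, hα⟩ : b ∣ x := hab.symm.dvd_of_dvd_mul_right ⟨h, by linarith⟩
    have hα0 : 0 < α := by
      by_contra hneg
      nlinarith
    have hh : h = α * a := by
      have : b * h = b * (α * a) := by rw [hα] at hD; linarith
      exact mul_left_cancel₀ (by omega) this
    have hy' : y = α * (A * b - a * N) := by rw [← hy, hα, hh]; ring
    refine ⟨α, hα0, by linarith, ⟨_, hy'⟩, ?_⟩
    rw [hy', abs_mul, abs_of_pos hα0, mul_assoc]
    exact mul_le_mul_of_nonneg_left hs hα0.le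
  · left
    have e : N * (x * a - h * b) = y * b - x * (A * b - a * N) := by rw [← hy]; ring
    have h1 : 1 ≤ |x * a - h * b| := Int.one_le_abs (sub_ne_zero.2 hD)
    have h2 : N ≤ |y| * b + x * |A * b - a * N| := by
      calc N ≤ N * |x * a - h * b| := by nlinarith
        _ = |N * (x * a - h * b)| := by rw [abs_mul, abs_of_pos hN]
        _ ≤ |y * b| + |x * (A * b - a * N)| := by rw [e]; exact abs_sub _ _
        _ = _ := by rw [abs_mul, abs_mul, abs_of_pos hx, abs_of_pos (by omega : 0 < b)]
    have h3 : 2 * x * |A * b - a * N| ≤ N := by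
      refine le_trans ?_ hs
      rw [mul_comm]
      exact mul_le_mul_of_nonneg_left hxb (abs_nonneg _)
    linarith

theorem sum_range_thueMorse_mul {t : ℕ → ℤ} (ht0 : t 0 = 1)
    (hte : ∀ n, t (2 * n) = t n) (hto : ∀ n, t (2 * n + 1) = - t n) (k : ℕ) (x : ℤ) :
    ∑ i ∈ range (3 * 2 ^ k), t i * x ^ i =
      (∏ j ∈ range k, (1 - x ^ 2 ^ j)) * (1 - x ^ 2 ^ k - (x ^ 2 ^ k) ^ 2) := by
  have step (m : ℕ) (x : ℤ) : ∑ i ∈ range (2 * m), t i * x ^ i =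
      (1 - x) * ∑ i ∈ range m, t i * (x ^ 2) ^ i := by
    induction m with
    | zero => simp
    | succ m ih =>
      rw [show 2 * (m + 1) = 2 * m + 1 + 1 by ring, sum_range_succ, sum_range_succ, ih,
        sum_range_succ, hte, hto]
      ring
  induction k generalizing x with
  | zero =>
    have h1 : t 1 = -1 := by have := hto 0; simpa [ht0] using this
    have h2 : t 2 = -1 := by have := hte 1; simpa [h1] using this
    simp [sum_range_succ, ht0, h1, h2]; ring
  | succ k ih =>
    rw [show 3 * 2 ^ (k + 1) = 2 * (3 * 2 ^ k) by ring, step, ih, prod_range_succ']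
    simp only [pow_succ', pow_zero, pow_one, mul_one]
    ring_nf

theorem le_pow_of_dvd_prod {ι : Type*} {s : Finset ι} {f : ι → ℤ} {α x e : ℤ} (he : 0 < e)
    (hx : α ∣ x) (hf : ∀ i ∈ s, f i ∣ x - e) (hα : α ∣ ∏ i ∈ s, f i) : α ≤ e ^ #s := by
  refine Int.le_of_dvd (by positivity) ?_
  have h1 : α ∣ (x - e) ^ #s := by
    rw [← prod_const]
    exact hα.trans (prod_dvd_prod_of_dvd _ _ hf)
  have h2 : α ∣ (e - x) ^ #s := by
    rw [← neg_sub, neg_pow]; exact h1.mul_left _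
  have h3 : α ∣ e ^ #s - (e - x) ^ #s :=
    (by simpa using hx : α ∣ e - (e - x)).trans (sub_dvd_pow_sub_pow _ _ _)
  exact (dvd_sub_left h2).1 h3

theorem abs_prod_one_sub_le {x : ℤ} (hx : 2 ≤ x) (k : ℕ) :
    |∏ j ∈ range k, (1 - x ^ 2 ^ j)| ≤ x ^ 2 ^ k := by
  induction k with
  | zero => simp; linarith
  | succ k ih =>
    rw [prod_range_succ, abs_mul, pow_succ 2 k, pow_mul, sq]
    have h1 : 1 ≤ x ^ 2 ^ k := one_le_pow₀ (by linarith)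
    have h2 : |1 - x ^ 2 ^ k| ≤ x ^ 2 ^ k := by rw [abs_le]; constructor <;> linarith
    gcongr

theorem pow_add_two_le_abs_prod_one_sub {x : ℤ} (hx : 2 ≤ x) (k : ℕ) :
    x ^ 2 ^ (k + 1) + 2 ≤ (x ^ 2 + 2) * |∏ j ∈ range (k + 1), (1 - x ^ 2 ^ j)| := by
  induction k with
  | zero =>
    have : 1 ≤ |1 - x| := by rw [abs_sub_comm, abs_of_nonneg] <;> linarith
    simp
    nlinarith
  | succ k ih =>
    rw [prod_range_succ, abs_mul, pow_succ 2 (k + 1), pow_mul x, sq (x ^ 2 ^ (k + 1))]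
    have h1 : 4 ≤ x ^ 2 ^ (k + 1) := by
      calc (4 : ℤ) = 2 ^ 2 := by norm_num
        _ ≤ x ^ 2 := by gcongr
        _ ≤ _ := pow_le_pow_right₀ (by linarith) (by rw [pow_succ]; have := Nat.one_le_two_pow (n := k); omega)
    set Q := x ^ 2 ^ (k + 1)
    have h2 : |1 - Q| = Q - 1 := by rw [abs_sub_comm, abs_of_nonneg]; linarith
    rw [h2]
    nlinarith [mul_le_mul_of_nonneg_right ih (by linarith : 0 ≤ Q - 1)]

theorem mul_lt_of_proportional {N R C α x b b' y : ℤ} (hN : 0 < N) (hα : 0 < α) (hR : 0 < R)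
    (hx : x = α * b) (hy : 0 < y) (hyb : y * b' ≤ α * N) (hαR : α ^ 2 ≤ R)
    (hb : C * R * b < b') : y * C * x < N := by
  have h1 : y * α * (C * R * b) < y * α * b' := by gcongr
  have h2 : α * (y * b') ≤ α * (α * N) := by gcongr
  have h3 : α ^ 2 * N ≤ R * N := by gcongr
  have h4 : R * (y * C * x) < R * N := by rw [hx]; linarith
  exact lt_of_mul_lt_mul_left h4 hR.le

theorem two_pow_le_pow_two_pow {p : ℤ} (hp : 2 ≤ p) {l : ℕ} (hl : 6 ≤ l) :
    2 ^ (8 * l) ≤ p ^ 2 ^ l := by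
  have h : 8 * l ≤ 2 ^ l := by
    induction l, hl using Nat.le_induction with
    | base => norm_num
    | succ l hl ih => rw [pow_succ]; omega
  calc (2 : ℤ) ^ (8 * l) ≤ 2 ^ 2 ^ l := pow_le_pow_right₀ (by norm_num) h
    _ ≤ _ := by gcongr

/-- If the partial quotient following a convergent `a / b` is large, then `a / b` is one specific
rational number. -/
theorem convergent_eq_of_large_quotient {p : ℤ} (hp : 2 ≤ p) {l : ℕ} (hl : 6 ≤ l)
    {R U A a b b' : ℤ} (hR : R = p ^ 2 ^ l) (hU : U = ∏ j ∈ range l, (1 - p ^ 2 ^ j))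
    (hA : A = U * (1 - R) * (1 - R ^ 2 - R ^ 4))
    (hab : IsCoprime a b) (hb : 1 ≤ b) (hne : A * b - a * R ^ 6 ≠ 0)
    (hs : |A * b - a * R ^ 6| * b' ≤ R ^ 6) (hbb : (p ^ 2 + 66) * R * b < b') :
    (R + 1) * a = U * b := by
  have h8 : 2 ^ (8 * l) ≤ R := hR ▸ two_pow_le_pow_two_pow hp hl
  have hR2 : 2 ≤ R := by
    refine le_trans ?_ h8
    exact le_self_pow₀ (by norm_num) (by omega)
  have hR0 : 0 < R := by linarith
  have hN : 0 < R ^ 6 := by positivity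
  have hp2 : 0 ≤ p ^ 2 := sq_nonneg p
  have hRb : 0 < R * b := by positivity
  have hpR : 0 ≤ p ^ 2 * (R * b) := by positivity
  have h66 : 66 * (R * b) < b' := by linarith
  have hb'0 : 0 < b' := by linarith
  have hb'N : b' ≤ R ^ 6 := by nlinarith [Int.one_le_abs hne]
  have hUle : |U| ≤ R := by rw [hU, hR]; exact abs_prod_one_sub_le hp l
  have hsq : p ^ 2 ^ (l + 1) = R ^ 2 := by rw [hR, pow_succ 2 l, pow_mul]
  have hP : U * (1 - R) = ∏ j ∈ range (l + 1), (1 - p ^ 2 ^ j) := by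
    rw [prod_range_succ, hU, hR]
  have hPle : |U * (1 - R)| ≤ R ^ 2 := by rw [hP, ← hsq]; exact abs_prod_one_sub_le hp _
  have hPge : R ^ 2 ≤ |U * (1 - R)| * (p ^ 2 + 66) := by
    have := pow_add_two_le_abs_prod_one_sub hp l
    rw [← hP, hsq] at this
    linarith [abs_nonneg (U * (1 - R))]
  have hUge : R ≤ |U| * (p ^ 2 + 66) := by
    obtain ⟨m, rfl⟩ : ∃ m, l = m + 1 := ⟨l - 1, by omega⟩
    have := pow_add_two_le_abs_prod_one_sub hp m
    rw [← hU, ← hR] at this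
    linarith [abs_nonneg U]
  have hU0 : 0 < |U| := by
    by_contra h
    nlinarith
  have hP0 : 0 < |U * (1 - R)| := by
    by_contra h
    nlinarith
  have hpow (i j : ℕ) (hij : i ≤ j) : R ^ i ≤ R ^ j := pow_le_pow_right₀ (by linarith) hij
  have d1 := hpow 0 1 (by norm_num)
  have d2 := hpow 1 2 (by norm_num)
  have d3 := hpow 2 3 (by norm_num)
  have d4 := hpow 3 4 (by norm_num)
  have d5 := hpow 4 5 (by norm_num)
  rw [pow_zero, pow_one] at d1
  rw [pow_one] at d2
  -- the approximation with denominator of order `R ^ 5`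
  have hb3 : b' < 28 * R ^ 5 := by
    by_contra! hcon
    obtain h | ⟨-, α, hα, hx, hαy, hy⟩ := le_denom_or_eq_convergent
      (x := (1 + R) * (1 + 2 * R ^ 2 + 4 * R ^ 4)) (h := U * (-7 + 2 * R ^ 2 + 4 * R ^ 4)) (y := U)
      hab hb hs (by positivity) (by linarith) (by rw [hA]; ring) hN
    · have : R ^ 6 ≤ 2 * R * b := h.trans (by gcongr)
      linarith
    · have hα14 : α ≤ 14 ^ l := by
        have := le_pow_of_dvd_prod (s := range l) (f := fun j => 1 - p ^ 2 ^ j) (e := 14)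
          (by norm_num) ⟨b, hx⟩ ?_ (hU ▸ hαy)
        · simpa using this
        · intro j hj
          have h1 : 1 - p ^ 2 ^ j ∣ 1 - R := by
            obtain ⟨d, hd⟩ := pow_dvd_pow 2 (mem_range.1 hj).le
            rw [hR, hd, pow_mul]
            exact one_sub_dvd_one_sub_pow _ _
          refine h1.trans ⟨-(13 + 12 * R + 10 * R ^ 2 + 8 * R ^ 3 + 4 * R ^ 4), by ring⟩
      have hα2 : α ^ 2 ≤ R := by
        calc α ^ 2 ≤ (14 ^ l) ^ 2 := by gcongr
          _ = 196 ^ l := by rw [← pow_mul, mul_comm, pow_mul]; norm_num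
          _ ≤ 256 ^ l := by gcongr; norm_num
          _ = 2 ^ (8 * l) := by rw [pow_mul]; norm_num
          _ ≤ R := h8
      have := mul_lt_of_proportional hN hα hR0 hx hU0 hy hα2 hbb
      have h2 : R * R ^ 5 ≤ |U| * (p ^ 2 + 66) * ((1 + R) * (1 + 2 * R ^ 2 + 4 * R ^ 4)) := by
        gcongr
        linarith
      linarith
  -- the approximation with denominator of order `R ^ 4`
  have hb4 : b' < 8 * R ^ 4 := by
    by_contra! hcon
    obtain h | ⟨-, α, hα, hx, hαy, hy⟩ := le_denom_or_eq_convergent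
      (x := 1 + R ^ 2 + 2 * R ^ 4) (h := U * (1 - R) * (-3 - 2 * R ^ 2)) (y := U * (1 - R))
      hab hb hs (by positivity) (by linarith) (by rw [hA]; ring) hN
    · have h1 : R ^ 2 * R ^ 4 ≤ R ^ 2 * (2 * b) := by
        calc R ^ 2 * R ^ 4 = R ^ 6 := by ring
          _ ≤ 2 * R ^ 2 * b := h.trans (by gcongr)
          _ = _ := by ring
      have h2 : R ^ 4 ≤ 2 * b := le_of_mul_le_mul_left h1 (by positivity)
      have h3 : R * R ^ 4 ≤ R * (2 * b) := by gcongr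
      linarith
    · have hα4 : α ≤ 4 ^ (l + 1) := by
        have := le_pow_of_dvd_prod (s := range (l + 1)) (f := fun j => 1 - p ^ 2 ^ j) (e := 4)
          (by norm_num) ⟨b, hx⟩ ?_ (hP ▸ hαy)
        · simpa using this
        · intro j hj
          have h1 : 1 - p ^ 2 ^ j ∣ 1 - R := by
            obtain ⟨d, hd⟩ := pow_dvd_pow 2 (Nat.lt_succ_iff.1 (mem_range.1 hj))
            rw [hR, hd, pow_mul]
            exact one_sub_dvd_one_sub_pow _ _
          refine h1.trans ⟨-((1 + R) * (3 + 2 * R ^ 2)), by ring⟩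
      have hα2 : α ^ 2 ≤ R := by
        calc α ^ 2 ≤ (4 ^ (l + 1)) ^ 2 := by gcongr
          _ = 2 ^ (4 * (l + 1)) := by
            rw [← pow_mul, pow_mul 2 4, mul_comm, pow_mul]; norm_num
          _ ≤ 2 ^ (8 * l) := pow_le_pow_right₀ (by norm_num) (by omega)
          _ ≤ R := h8
      have := mul_lt_of_proportional hN hα hR0 hx hP0 hy hα2 hbb
      have h2 : R ^ 2 * R ^ 4 ≤ |U * (1 - R)| * (p ^ 2 + 66) * (1 + R ^ 2 + 2 * R ^ 4) := by
        gcongr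
        nlinarith
      linarith
  -- the approximation with denominator `R + 1`
  obtain h | ⟨h, -⟩ := le_denom_or_eq_convergent
      (x := R + 1) (h := U) (y := U * (1 - 2 * R ^ 2)) hab hb hs (by positivity)
      (by nlinarith) (by rw [hA]; ring) hN
  · have h0 : |U * (1 - 2 * R ^ 2)| ≤ 2 * R ^ 3 := by
      have : |1 - 2 * R ^ 2| ≤ 2 * R ^ 2 := by rw [abs_le]; constructor <;> linarith
      calc |U * (1 - 2 * R ^ 2)| ≤ R * (2 * R ^ 2) := by rw [abs_mul]; gcongr
        _ = _ := by ring
    have h1 : R ^ 3 * R ^ 3 ≤ R ^ 3 * (4 * b) := by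
      calc R ^ 3 * R ^ 3 = R ^ 6 := by ring
        _ ≤ 2 * (2 * R ^ 3) * b := h.trans (by gcongr)
        _ = _ := by ring
    have h2 : R ^ 3 ≤ 4 * b := le_of_mul_le_mul_left h1 (by positivity)
    have h3 : R * R ^ 3 ≤ R * (4 * b) := by gcongr
    linarith
  · exact h

theorem IsCoprime.eq_of_mul_eq_mul {a b c d : ℤ} (hab : IsCoprime a b) (hcd : IsCoprime c d)
    (hb : 0 < b) (hd : 0 < d) (h : a * d = c * b) : b = d :=
  Int.dvd_antisymm hb.le hd.le (hab.symm.dvd_of_dvd_mul_left ⟨c, by linarith⟩)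
    (hcd.symm.dvd_of_dvd_mul_left ⟨a, by linarith⟩)

theorem tm_second_largest_partial_quotient_small (p : ℕ) [Fact p.Prime]
    (t : ℕ → ℤ) (ht0 : t 0 = 1)
    (hte : ∀ n, t (2 * n) = t n) (hto : ∀ n, t (2 * n + 1) = - t n)
    (z : ℕ → ℚ) (hz : ∀ m, z m = ∑ i ∈ Finset.range m, (t i : ℚ) / (p : ℚ) ^ (m - i)) :
    ∃ c : ℝ, 0 < c ∧ ∃ K : ℕ, ∀ k : ℕ, K ≤ k →
      {n : ℕ | ∃ q : ℚ, (GenContFract.of (z (3 * 2 ^ k))).partDens.get? n = some q ∧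
        c * (p : ℝ) ^ (2 ^ (k - 1)) < (q : ℝ)}.Subsingleton := by
  have hp : (2 : ℤ) ≤ p := by exact_mod_cast (Fact.out : p.Prime).two_le
  refine ⟨(p : ℝ) ^ 2 + 66, by positivity, 7, fun k hk => ?_⟩
  obtain ⟨l, rfl⟩ : ∃ l, k = l + 1 := ⟨k - 1, by omega⟩
  rw [Nat.add_sub_cancel]
  obtain ⟨R, hR⟩ : ∃ R : ℤ, R = (p : ℤ) ^ 2 ^ l := ⟨_, rfl⟩
  obtain ⟨U, hU⟩ : ∃ U : ℤ, U = ∏ j ∈ range l, (1 - (p : ℤ) ^ 2 ^ j) := ⟨_, rfl⟩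
  obtain ⟨A, hA⟩ : ∃ A : ℤ, A = U * (1 - R) * (1 - R ^ 2 - R ^ 4) := ⟨_, rfl⟩
  have hR1 : 1 ≤ R := hR ▸ one_le_pow₀ (by linarith)
  have hRQ : (1 : ℚ) ≤ R := by exact_mod_cast hR1
  have hzA : z (3 * 2 ^ (l + 1)) * (R : ℚ) ^ 6 = A := by
    have hpQ : (p : ℚ) ≠ 0 := by
      have : (p : ℤ) ≠ 0 := by omega
      exact_mod_cast this
    have hsum := sum_range_thueMorse_mul ht0 hte hto (l + 1) (p : ℤ)
    have hRp : (p : ℤ) ^ 2 ^ (l + 1) = R ^ 2 := by rw [hR, pow_succ 2 l, pow_mul]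
    rw [prod_range_succ, ← hU, ← hR, hRp, ← pow_mul, ← hA] at hsum
    have hRN : (R : ℚ) ^ 6 = (p : ℚ) ^ (3 * 2 ^ (l + 1)) := by
      rw [hR]; push_cast; rw [← pow_mul]; congr 1; ring
    rw [hRN, hz, ← hsum, sum_mul]
    push_cast
    refine sum_congr rfl fun i hi => ?_
    obtain ⟨d, hd⟩ := Nat.exists_eq_add_of_lt (mem_range.1 hi)
    rw [hd, show i + d + 1 - i = d + 1 by omega, show i + d + 1 = i + (d + 1) by ring, pow_add]
    field_simp
    ring
  have key (n : ℕ) (q : ℚ) (hq : (of (z (3 * 2 ^ (l + 1)))).partDens.get? n = some q)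
      (hlt : ((p : ℝ) ^ 2 + 66) * (p : ℝ) ^ 2 ^ l < q) :
      ∃ a b b' : ℤ, (of (z (3 * 2 ^ (l + 1)))).dens n = b ∧
        (of (z (3 * 2 ^ (l + 1)))).dens (n + 1) = b' ∧ IsCoprime a b ∧ 1 ≤ b ∧ b < b' ∧
        (R + 1) * a = U * b := by
    obtain ⟨a, b, b', hden, hden', hab, hb, hqb, hne, hle⟩ :=
      GenContFract.exists_int_convergent _ hq
    have hbQ : (1 : ℚ) ≤ b := by exact_mod_cast hb
    have hlt' : ((p : ℚ) ^ 2 + 66) * R < q := by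
      rw [hR]; exact_mod_cast hlt
    have hbb : ((p : ℤ) ^ 2 + 66) * R * b < b' := by
      have : ((p : ℚ) ^ 2 + 66) * R * b < b' := lt_of_lt_of_le (by gcongr) hqb
      exact_mod_cast this
    have e : ((A * b - a * R ^ 6 : ℤ) : ℚ) = (z (3 * 2 ^ (l + 1)) * b - a) * R ^ 6 := by
      push_cast; rw [← hzA]; ring
    refine ⟨a, b, b', hden, hden', hab, hb, ?_,
      convergent_eq_of_large_quotient hp (by omega) hR hU hA hab hb ?_ ?_ hbb⟩
    · have : 1 * b ≤ ((p : ℤ) ^ 2 + 66) * R * b := by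
        gcongr
        nlinarith [sq_nonneg (p : ℤ)]
      linarith
    · intro h0
      rw [h0, Int.cast_zero, eq_comm, mul_eq_zero] at e
      rcases e with e | e
      · exact hne (sub_eq_zero.1 e)
      · exact absurd e (by positivity)
    · have : |((A * b - a * R ^ 6 : ℤ) : ℚ)| * b' ≤ R ^ 6 := by
        rw [e, abs_mul, abs_of_pos (by positivity : (0 : ℚ) < R ^ 6), mul_right_comm]
        exact mul_le_of_le_one_left (by positivity) hle
      exact_mod_cast this
  have not_lt_of_large (n m : ℕ) (hn : ∃ q : ℚ, (of (z (3 * 2 ^ (l + 1)))).partDens.get? n = some q ∧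
        ((p : ℝ) ^ 2 + 66) * (p : ℝ) ^ 2 ^ l < q)
      (hm : ∃ q : ℚ, (of (z (3 * 2 ^ (l + 1)))).partDens.get? m = some q ∧
        ((p : ℝ) ^ 2 + 66) * (p : ℝ) ^ 2 ^ l < q) : ¬ n < m := by
    intro hnm
    obtain ⟨q, hq, hlt⟩ := hn
    obtain ⟨q', hq', hlt'⟩ := hm
    obtain ⟨a, b, b₁, hden, hden₁, hab, hb, hbb, hconv⟩ := key n q hq hlt
    obtain ⟨c, d, -, hden', -, hcd, hd, -, hconv'⟩ := key m q' hq' hlt'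
    have hmono : Monotone (of (z (3 * 2 ^ (l + 1)))).dens :=
      monotone_nat_of_le_succ fun _ => GenContFract.of_den_mono
    have h1 : b₁ ≤ d := by
      have := hmono (Nat.succ_le_of_lt hnm)
      rw [Nat.succ_eq_add_one, hden₁, hden'] at this
      exact_mod_cast this
    have h2 : b = d := by
      refine hab.eq_of_mul_eq_mul hcd (by omega) (by omega) ?_
      refine mul_left_cancel₀ (by omega : R + 1 ≠ 0) ?_
      linear_combination d * hconv - b * hconv'
    omega
  exact fun n hn m hm => le_antisymm (not_lt.1 (not_lt_of_large m n hm hn))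
    (not_lt.1 (not_lt_of_large n m hn hm))
end

section
/- Let p be a prime number. For every ε > 0 there exists an integer K such that for every k ≥ K, all the partial quotients of the continued fraction expansion of the rational number z_{2^k} are less than p^{ε 2^k}. -/
open Polynomial in
theorem Polynomial.exists_expand_two_add_X_mul {R : Type*} [CommRing R] (P : R[X]) :
    ∃ E O : R[X], P = expand R 2 E + X * expand R 2 O := by
  induction P using Polynomial.induction_on' with
  | add P Q hP hQ =>
    obtain ⟨E, O, rfl⟩ := hP
    obtain ⟨E', O', rfl⟩ := hQ
    exact ⟨E + E', O + O', by simp only [map_add]; ring⟩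
  | monomial n a =>
    rcases Nat.even_or_odd' n with ⟨k, rfl | rfl⟩
    · exact ⟨C a * X ^ k, 0, by simp [← C_mul_X_pow_eq_monomial, pow_mul]⟩
    · exact ⟨0, C a * X ^ k, by simp [← C_mul_X_pow_eq_monomial, pow_mul, pow_succ]; ring⟩

open Polynomial in
theorem Polynomial.coeff_expand_two_add_even {R : Type*} [CommRing R] (E O : R[X]) (i : ℕ) :
    (expand R 2 E + X * expand R 2 O).coeff (2 * i) = E.coeff i := by
  rcases i with _ | i
  · simp [coeff_expand]
  · rw [coeff_add, show 2 * (i + 1) = (2 * i + 1) + 1 by ring, coeff_X_mul, coeff_expand two_pos,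
      coeff_expand two_pos, if_pos (by omega), if_neg (by omega), add_zero]
    congr 1; omega

open Polynomial in
theorem Polynomial.coeff_expand_two_add_odd {R : Type*} [CommRing R] (E O : R[X]) (i : ℕ) :
    (expand R 2 E + X * expand R 2 O).coeff (2 * i + 1) = O.coeff i := by
  rw [coeff_add, coeff_X_mul, coeff_expand two_pos, coeff_expand two_pos, if_neg (by omega),
    if_pos (by omega), zero_add]
  congr 1; omega

open Polynomial in
theorem Polynomial.degree_lt_of_expand_two_add {R : Type*} [CommRing R] {E O : R[X]} {n : ℕ}
    (h : degree (expand R 2 E + X * expand R 2 O) < (n : WithBot ℕ)) :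
    E.degree < ((n + 1) / 2 : ℕ) ∧ O.degree < (n / 2 : ℕ) := by
  simp only [degree_lt_iff_coeff_zero] at h ⊢
  refine ⟨fun m hm => ?_, fun m hm => ?_⟩
  · rw [← coeff_expand_two_add_even E O]; exact h _ (by omega)
  · rw [← coeff_expand_two_add_odd E O]; exact h _ (by omega)

open Polynomial in
theorem Polynomial.X_pow_dvd_of_expand_two_add {R : Type*} [CommRing R] {E O : R[X]} {n : ℕ}
    (h : X ^ (2 * n) ∣ expand R 2 E + X * expand R 2 O) : X ^ n ∣ E ∧ X ^ n ∣ O := by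
  simp only [X_pow_dvd_iff] at h ⊢
  refine ⟨fun m hm => ?_, fun m hm => ?_⟩
  · rw [← coeff_expand_two_add_even E O]; exact h _ (by omega)
  · rw [← coeff_expand_two_add_odd E O]; exact h _ (by omega)

open Polynomial in
theorem Polynomial.degree_mul_one_add_X_lt_iff {R : Type*} [CommRing R] [IsDomain R] {P : R[X]}
    {n : ℕ} : ((1 + X) * P).degree < ((n + 1 : ℕ) : WithBot ℕ) ↔ P.degree < n := by
  rw [degree_mul, add_comm (1 : R[X]), show (X + 1 : R[X]).degree = 1 from degree_X_add_C 1]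
  rcases eq_or_ne P 0 with rfl | hP
  · simp
  · rw [degree_eq_natDegree hP]; norm_cast; omega

open Polynomial in
theorem Polynomial.eq_zero_of_X_pow_dvd_of_degree_lt {R : Type*} [CommRing R] {P : R[X]} {n : ℕ}
    (h : X ^ n ∣ P) (hd : P.degree < n) : P = 0 := by
  ext i
  rcases lt_or_ge i n with hi | hi
  · exact X_pow_dvd_iff.1 h i hi
  · exact (degree_lt_iff_coeff_zero _ _).1 hd i hi

open Polynomial in
theorem Polynomial.X_pow_dvd_of_mul_one_add_X {R : Type*} [CommRing R] {P : R[X]} {n : ℕ}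
    (h : X ^ n ∣ (1 + X) * P) : X ^ n ∣ P :=
  (IsCoprime.pow_left (m := n) ⟨-1, 1, by ring⟩ :
    IsCoprime (X ^ n) (1 + X : R[X])).dvd_of_dvd_mul_left h

open Polynomial in
theorem exists_eq_one_add_X_mul_of_eval_one {P : (ZMod 2)[X]} (h : P.eval 1 = 0) :
    ∃ Q, P = (1 + X) * Q := by
  obtain ⟨Q, rfl⟩ := dvd_iff_isRoot.2 h
  exact ⟨Q, by rw [CharTwo.sub_eq_add, map_one, add_comm]⟩

open Polynomial in
/-- The sequence `h s` of truncations of the series `h ∈ 𝔽₂⟦X⟧` with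
`(1 + X) h(X) = X + (1 + X) h(X²)`. -/
def IsTruncation (h : ℕ → (ZMod 2)[X]) : Prop :=
  ∀ s, X ^ 2 ^ (s + 1) ∣ (1 + X) * h (s + 1) - X - (1 + X) * expand (ZMod 2) 2 (h s)

open Polynomial in
/-- `P` is a denominator of a Padé approximation of `h` with degrees less than `(e, d)`. -/
def IsPadeDenom (h : (ZMod 2)[X]) (n e d : ℕ) (P : (ZMod 2)[X]) : Prop :=
  P.degree < e ∧ ∃ D : (ZMod 2)[X], D.degree < d ∧ X ^ n ∣ P * h - D

open Polynomial in
theorem degree_lt_of_degree_lt {P : (ZMod 2)[X]} {m n : ℕ} (h : P.degree < m) (hmn : m ≤ n) :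
    P.degree < n := h.trans_le (by exact_mod_cast hmn)

open Polynomial in
theorem degree_X_mul_lt {P : (ZMod 2)[X]} {m : ℕ} (h : P.degree < m) :
    degree (X * P) < ((m + 1 : ℕ) : WithBot ℕ) := by
  rw [degree_lt_iff_coeff_zero] at h ⊢
  intro i hi
  obtain ⟨i, rfl⟩ : ∃ j, i = j + 1 := ⟨i - 1, by omega⟩
  rw [coeff_X_mul]
  exact h _ (by omega)

open Polynomial in
theorem two_eq_zero_poly : (2 : (ZMod 2)[X]) = 0 := CharTwo.two_eq_zero

open Polynomial in
theorem pade_step_of_eval_one_eq_zero {h h' E : (ZMod 2)[X]} {n e d : ℕ}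
    (hh : X ^ (2 * n) ∣ (1 + X) * h - X - (1 + X) * expand (ZMod 2) 2 h')
    (ih : ∀ e d P, e ≤ d → e + d ≤ n + 1 → IsPadeDenom h' n e d P → P.eval 1 = 0 → P = 0)
    (ih' : ∀ e d P, e ≤ d → e + d ≤ n → IsPadeDenom h' n e d P → P = 0)
    (hed : e ≤ d) (hn : e + d ≤ 2 * n + 1) (hE : IsPadeDenom h (2 * n) e d E)
    (hE1 : E.eval 1 = 0) : E = 0 := by
  obtain ⟨hEe, D, hD, hdvd⟩ := hE
  rcases e with _ | e
  · simpa using hEe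
  obtain ⟨B, rfl⟩ := exists_eq_one_add_X_mul_of_eval_one hE1
  rw [degree_mul_one_add_X_lt_iff] at hEe
  obtain ⟨Be, Bo, hB⟩ := exists_expand_two_add_X_mul B
  obtain ⟨We, Wo, hW⟩ := exists_expand_two_add_X_mul ((1 + X) * (D + X * B))
  have hWd : degree ((1 + X) * (D + X * B)) < ((d + 1 : ℕ) : WithBot ℕ) :=
    degree_mul_one_add_X_lt_iff.2 <| (degree_add_le _ _).trans_lt <|
      max_lt hD (degree_lt_of_degree_lt (degree_X_mul_lt hEe) hed)
  have key : X ^ (2 * n) ∣ expand (ZMod 2) 2 ((1 + X) * Be * h' - We) +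
      X * expand (ZMod 2) 2 ((1 + X) * Bo * h' - Wo) := by
    have : expand (ZMod 2) 2 ((1 + X) * Be * h' - We) +
        X * expand (ZMod 2) 2 ((1 + X) * Bo * h' - Wo) =
        (1 + X) * ((1 + X) * B * h - D) - (1 + X) * B *
          ((1 + X) * h - X - (1 + X) * expand (ZMod 2) 2 h') := by
      simp only [map_sub, map_mul, map_add, map_one, expand_X]
      linear_combination (-(1 + X ^ 2) * expand (ZMod 2) 2 h') * hB + hW +
        (-X * (1 + X) * B - X * B * expand (ZMod 2) 2 h') * two_eq_zero_poly
    rw [this]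
    exact dvd_sub (hdvd.mul_left _) (hh.mul_left _)
  obtain ⟨ke, ko⟩ := X_pow_dvd_of_expand_two_add key
  have dB := degree_lt_of_expand_two_add (hB ▸ hEe)
  have dW := degree_lt_of_expand_two_add (hW ▸ hWd)
  have hBo : Bo = 0 := by
    have := ih (e / 2 + 1) ((d + 1) / 2) ((1 + X) * Bo) (by omega) (by omega)
      ⟨degree_mul_one_add_X_lt_iff.2 dB.2, Wo, dW.2, ko⟩ (by simp [CharTwo.add_self_eq_zero])
    exact (mul_eq_zero.1 this).resolve_left (by rw [add_comm]; exact X_add_C_ne_zero 1)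
  subst hBo
  have hWo : Wo = 0 := eq_zero_of_X_pow_dvd_of_degree_lt (n := n) (by simpa using ko)
    (degree_lt_of_degree_lt dW.2 (by omega))
  subst hWo
  have hWe : We.eval 1 = 0 := by
    have := congrArg (eval 1) hW
    simpa [CharTwo.add_self_eq_zero, expand_eval] using this.symm
  obtain ⟨D₁, rfl⟩ := exists_eq_one_add_X_mul_of_eval_one hWe
  have hne : (1 + X : (ZMod 2)[X]) ≠ 0 := by rw [add_comm]; exact X_add_C_ne_zero 1
  have hD' : D = expand (ZMod 2) 2 D₁ + X * expand (ZMod 2) 2 (D₁ + Be) := by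
    refine mul_left_cancel₀ hne ?_
    simp only [map_zero, map_mul, map_add, map_one, expand_X] at hW hB ⊢
    linear_combination hW - X * (1 + X) * hB +
      (-X * expand (ZMod 2) 2 D₁ - X * (1 + X) * expand (ZMod 2) 2 Be) * two_eq_zero_poly
  have dD := (degree_lt_of_expand_two_add (hD' ▸ hD)).2
  have hBe : Be = 0 := by
    refine ih' ((e + 1) / 2) (d / 2) Be (by omega) (by omega) ⟨dB.1, D₁, ?_, ?_⟩
    · have : D₁ = (D₁ + Be) - Be := by ring
      rw [this]
      exact (degree_sub_le _ _).trans_lt <|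
        max_lt dD (degree_lt_of_degree_lt dB.1 (by omega))
    · exact X_pow_dvd_of_mul_one_add_X (by rw [mul_sub, ← mul_assoc]; exact ke)
  simp [hB, hBe]

open Polynomial in
theorem pade_step {h h' E : (ZMod 2)[X]} {n e d : ℕ}
    (hh : X ^ (2 * n) ∣ (1 + X) * h - X - (1 + X) * expand (ZMod 2) 2 h')
    (ih : ∀ e d P, e ≤ d → e + d ≤ n + 1 → IsPadeDenom h' n e d P → P.eval 1 = 0 → P = 0)
    (ih' : ∀ e d P, e ≤ d → e + d ≤ n → IsPadeDenom h' n e d P → P = 0)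
    (hed : e ≤ d) (hn : e + d ≤ 2 * n) (hE : IsPadeDenom h (2 * n) e d E) : E = 0 := by
  wlog hpar : (e + d) % 2 = 0 generalizing d
  · obtain ⟨hEe, D, hD, hdvd⟩ := hE
    exact this (d := d + 1) (by omega) (by omega)
      ⟨hEe, D, degree_lt_of_degree_lt hD (by omega), hdvd⟩ (by omega)
  have hne : (1 + X : (ZMod 2)[X]) ≠ 0 := by rw [add_comm]; exact X_add_C_ne_zero 1
  obtain ⟨hEe, D, hD, hdvd⟩ := hE
  obtain ⟨P, Q, hP⟩ := exists_expand_two_add_X_mul ((1 + X) * E)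
  obtain ⟨We, Wo, hW⟩ := exists_expand_two_add_X_mul ((1 + X) * D - X * E)
  have hEd : degree ((1 + X) * E) < ((e + 1 : ℕ) : WithBot ℕ) := degree_mul_one_add_X_lt_iff.2 hEe
  have hWd : degree ((1 + X) * D - X * E) < ((d + 1 : ℕ) : WithBot ℕ) :=
    (degree_sub_le _ _).trans_lt <| max_lt (degree_mul_one_add_X_lt_iff.2 hD)
      (degree_lt_of_degree_lt (degree_X_mul_lt hEe) (by omega))
  have key : X ^ (2 * n) ∣ expand (ZMod 2) 2 (P * h' - We) +
      X * expand (ZMod 2) 2 (Q * h' - Wo) := by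
    have : expand (ZMod 2) 2 (P * h' - We) + X * expand (ZMod 2) 2 (Q * h' - Wo) =
        (1 + X) * (E * h - D) - E *
          ((1 + X) * h - X - (1 + X) * expand (ZMod 2) 2 h') := by
      simp only [map_sub, map_mul]
      linear_combination (- expand (ZMod 2) 2 h') * hP + hW
    rw [this]
    exact dvd_sub (hdvd.mul_left _) (hh.mul_left _)
  obtain ⟨ke, ko⟩ := X_pow_dvd_of_expand_two_add key
  have dP := degree_lt_of_expand_two_add (hP ▸ hEd)
  have dW := degree_lt_of_expand_two_add (hW ▸ hWd)
  have hPQ : P.eval 1 + Q.eval 1 = 0 := by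
    have := congrArg (eval 1) hP
    simpa [CharTwo.add_self_eq_zero, expand_eval] using this.symm
  rcases Nat.even_or_odd' e with ⟨ε, rfl | rfl⟩
  · have hQ : Q = 0 := ih' ((2 * ε + 1) / 2) ((d + 1) / 2) Q (by omega) (by omega)
      ⟨dP.2, Wo, dW.2, ko⟩
    subst hQ
    have hWo : Wo = 0 := eq_zero_of_X_pow_dvd_of_degree_lt (n := n) (by simpa using ko)
      (degree_lt_of_degree_lt dW.2 (by omega))
    subst hWo
    obtain ⟨P₁, rfl⟩ := exists_eq_one_add_X_mul_of_eval_one (by simpa using hPQ : P.eval 1 = 0)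
    have hE' : E = expand (ZMod 2) 2 P₁ + X * expand (ZMod 2) 2 P₁ := by
      refine mul_left_cancel₀ hne ?_
      simp only [map_zero, map_mul, map_add, map_one, expand_X] at hP ⊢
      linear_combination hP - X * expand (ZMod 2) 2 P₁ * two_eq_zero_poly
    have hWe : We.eval 1 = 0 := by
      have := congrArg (eval 1) hW
      simpa [CharTwo.add_self_eq_zero, expand_eval, hE'] using this.symm
    obtain ⟨R₁, rfl⟩ := exists_eq_one_add_X_mul_of_eval_one hWe
    have hD' : D = expand (ZMod 2) 2 R₁ + X * expand (ZMod 2) 2 (P₁ + R₁) := by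
      refine mul_left_cancel₀ hne ?_
      simp only [map_zero, map_mul, map_add, map_one, expand_X] at hW ⊢
      linear_combination hW + X * hE' - X * expand (ZMod 2) 2 R₁ * two_eq_zero_poly
    have dP₁ := degree_lt_of_expand_two_add (hE' ▸ hEe)
    have dR₁ := degree_lt_of_expand_two_add (hD' ▸ hD)
    have hP₁ : P₁ = 0 := ih' (2 * ε / 2) ((d + 1) / 2) P₁ (by omega) (by omega)
      ⟨dP₁.2, R₁, dR₁.1,
        X_pow_dvd_of_mul_one_add_X (by rw [mul_sub, ← mul_assoc]; exact ke)⟩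
    simp [hE', hP₁]
  · have hPQ0 : P + Q = 0 := ih (ε + 1) ((d + 1) / 2) (P + Q) (by omega) (by omega)
      ⟨(degree_add_le _ _).trans_lt <| max_lt (degree_lt_of_degree_lt dP.1 (by omega))
          (degree_lt_of_degree_lt dP.2 (by omega)), We + Wo,
        (degree_add_le _ _).trans_lt <| max_lt (degree_lt_of_degree_lt dW.1 (by omega)) dW.2,
        by convert dvd_add ke ko using 1; ring⟩ (by simpa using hPQ)
    obtain rfl : P = Q := CharTwo.add_eq_zero.1 hPQ0
    have hWW : We = Wo := by
      refine sub_eq_zero.1 (eq_zero_of_X_pow_dvd_of_degree_lt (n := n) ?_ ?_)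
      · convert dvd_sub ko ke using 1; ring
      · exact (degree_sub_le _ _).trans_lt <| max_lt (degree_lt_of_degree_lt dW.1 (by omega))
          (degree_lt_of_degree_lt dW.2 (by omega))
    subst hWW
    have hE' : E = expand (ZMod 2) 2 P := mul_left_cancel₀ hne (by rw [hP]; ring)
    have hE1 : P.eval 1 = 0 := by
      have := congrArg (eval 1) hW
      simpa [CharTwo.add_self_eq_zero, expand_eval, hE'] using this
    have hP0 : P = 0 := ih (ε + 1) ((d + 1) / 2) P (by omega) (by omega)
      ⟨degree_lt_of_degree_lt dP.1 (by omega), We, dW.2, ko⟩ hE1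
    simp [hE', hP0]

open Polynomial in
theorem IsTruncation.eq_zero_of_isPadeDenom {h : ℕ → (ZMod 2)[X]} (hh : IsTruncation h) (s : ℕ) :
    (∀ e d P, e ≤ d → e + d ≤ 2 ^ s + 1 → IsPadeDenom (h s) (2 ^ s) e d P →
      P.eval 1 = 0 → P = 0) ∧
    ∀ e d P, e ≤ d → e + d ≤ 2 ^ s → IsPadeDenom (h s) (2 ^ s) e d P → P = 0 := by
  induction s with
  | zero =>
    refine ⟨fun e d P hed hn hP h1 => ?_, fun e d P hed hn hP => ?_⟩
    · have : P.degree < (1 : ℕ) := degree_lt_of_degree_lt hP.1 (by omega)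
      rw [eq_C_of_degree_le_zero (Order.lt_succ_iff.1 this)] at h1 ⊢
      simpa using h1
    · have : P.degree < (0 : ℕ) := degree_lt_of_degree_lt hP.1 (by omega)
      simpa using this
  | succ s ih =>
    have hs := hh s
    rw [pow_succ'] at hs ⊢
    exact ⟨fun e d P hed hn hP h1 => pade_step_of_eval_one_eq_zero hs ih.1 ih.2 hed hn hP h1,
      fun e d P hed hn hP => pade_step hs ih.1 ih.2 hed hn hP⟩

open Polynomial in
/-- The Thue–Morse polynomials `∏ j < s, (1 - X ^ 2 ^ j)`. -/
noncomputable def thueMorsePoly : ℕ → ℤ[X]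
  | 0 => 1
  | s + 1 => (1 - X) * expand ℤ 2 (thueMorsePoly s)

open Polynomial in
/-- Polynomials `G` with `(1 - X) * thueMorsePoly s ≡ 1 - 2 * G` modulo `X ^ 2 ^ s`. -/
noncomputable def thueMorseHalf : ℕ → ℤ[X]
  | 0 => 0
  | s + 1 => (∑ i ∈ Finset.range (2 ^ (s + 1)), (-X) ^ i) *
      (X + (1 - X) * expand ℤ 2 (thueMorseHalf s))

open Polynomial in
theorem one_add_X_mul_thueMorseHalf_succ (s : ℕ) :
    (1 + X) * thueMorseHalf (s + 1) =
      (1 - X ^ 2 ^ (s + 1)) * (X + (1 - X) * expand ℤ 2 (thueMorseHalf s)) := by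
  have h := mul_neg_geom_sum (-X : ℤ[X]) (2 ^ (s + 1))
  rw [Even.neg_pow ((Nat.even_pow.2 ⟨even_two, by omega⟩)), sub_neg_eq_add] at h
  rw [thueMorseHalf, ← mul_assoc, h]

open Polynomial in
theorem X_pow_dvd_one_sub_X_mul_thueMorsePoly (s : ℕ) :
    X ^ 2 ^ s ∣ (1 - X) * thueMorsePoly s - (1 - 2 * thueMorseHalf s) := by
  induction s with
  | zero => exact ⟨-1, by simp [thueMorsePoly, thueMorseHalf]⟩
  | succ s ih =>
    obtain ⟨T, hT⟩ := ih
    apply X_pow_dvd_of_mul_one_add_X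
    have hT' := congrArg (expand ℤ 2) hT
    simp only [map_sub, map_mul, map_one, expand_X, map_pow, ← pow_mul, ← pow_succ', map_ofNat]
      at hT'
    refine ⟨(1 - X) * expand ℤ 2 T -
      2 * (X + (1 - X) * expand ℤ 2 (thueMorseHalf s)), ?_⟩
    rw [thueMorsePoly]
    linear_combination (1 - X) * hT' + 2 * one_add_X_mul_thueMorseHalf_succ s

open Polynomial in
theorem isTruncation_map_thueMorseHalf :
    IsTruncation fun s => (thueMorseHalf s).map (Int.castRingHom (ZMod 2)) := by
  intro s
  have h := congrArg (map (Int.castRingHom (ZMod 2))) (one_add_X_mul_thueMorseHalf_succ s)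
  simp only [Polynomial.map_mul, Polynomial.map_add, Polynomial.map_sub, Polynomial.map_one,
    map_X, Polynomial.map_pow, map_expand] at h
  refine ⟨-(X + (1 - X) * expand (ZMod 2) 2 ((thueMorseHalf s).map (Int.castRingHom _))), ?_⟩
  linear_combination h -
    X * expand (ZMod 2) 2 ((thueMorseHalf s).map (Int.castRingHom _)) * two_eq_zero_poly

open Polynomial in
theorem exists_eq_two_mul_of_map_eq_zero {P : ℤ[X]}
    (h : P.map (Int.castRingHom (ZMod 2)) = 0) : ∃ Q, P = 2 * Q := by
  have : C (2 : ℤ) ∣ P := by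
    rw [C_dvd_iff_dvd_coeff]
    intro i
    have := congrArg (coeff · i) h
    exact (ZMod.intCast_zmod_eq_zero_iff_dvd (P.coeff i) 2).1 (by simpa using this)
  exact this

open Polynomial in
theorem degree_two_mul (P : ℤ[X]) : (2 * P).degree = P.degree :=
  degree_C_mul (a := (2 : ℤ)) two_ne_zero

open Polynomial in
theorem X_pow_dvd_two_mul_iff {P : ℤ[X]} {n : ℕ} : X ^ n ∣ 2 * P ↔ X ^ n ∣ P := by
  simp only [X_pow_dvd_iff, show (2 : ℤ[X]) = C 2 from rfl, coeff_C_mul, mul_eq_zero,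
    two_ne_zero, false_or]

open Polynomial in
theorem map_eq_zero_of_X_pow_dvd {A B : ℤ[X]} {s a b : ℕ} (hab : a + b = 2 ^ s)
    (hA : A.degree < a) (hB : B.degree < b) (h : X ^ 2 ^ s ∣ A * thueMorsePoly s - B) :
    A.map (Int.castRingHom (ZMod 2)) = 0 ∧ B.map (Int.castRingHom (ZMod 2)) = 0 := by
  set φ := Int.castRingHom (ZMod 2)
  have h2 : X ^ 2 ^ s ∣ A - (1 - X) * B - 2 * (A * thueMorseHalf s) := by
    convert dvd_sub (h.mul_left (1 - X)) ((X_pow_dvd_one_sub_X_mul_thueMorsePoly s).mul_left A)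
      using 1
    ring
  rcases Nat.eq_zero_or_pos a with rfl | ha
  · have hA0 : A = 0 := by simpa using hA
    subst hA0
    have : B = 0 := eq_zero_of_X_pow_dvd_of_degree_lt (by simpa using h) (by rwa [← hab, zero_add])
    simp [this]
  have hdB : degree ((1 - X) * B) < ((b + 1 : ℕ) : WithBot ℕ) := by
    rw [show (1 - X) * B = -((X - C 1) * B) by simp; ring, degree_neg, degree_mul,
      degree_X_sub_C]
    rcases eq_or_ne B 0 with rfl | hB0
    · simp
    · rw [degree_eq_natDegree hB0] at hB ⊢
      norm_cast at hB ⊢; omega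
  have hd : degree (A - (1 - X) * B) < ((max a (b + 1) : ℕ) : WithBot ℕ) := by
    refine (degree_sub_le _ _).trans_lt (max_lt (hA.trans_le ?_) (hdB.trans_le ?_)) <;>
      norm_cast <;> simp
  have hm : (A - (1 - X) * B).map φ = 0 := by
    refine eq_zero_of_X_pow_dvd_of_degree_lt (n := 2 ^ s) ?_
      (degree_map_le.trans_lt (hd.trans_le ?_))
    · have := Polynomial.map_dvd φ h2
      simpa [show ((2 : (ZMod 2)[X])) = 0 from two_eq_zero_poly] using this
    · norm_cast; omega
  obtain ⟨D, hD⟩ := exists_eq_two_mul_of_map_eq_zero hm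
  rw [hD, ← mul_sub, X_pow_dvd_two_mul_iff] at h2
  rw [hD, degree_two_mul] at hd
  have hAB : A.map φ = (1 + X) * B.map φ := by
    simp only [Polynomial.map_sub, Polynomial.map_mul, Polynomial.map_one, map_X] at hm
    linear_combination hm - X * B.map φ * two_eq_zero_poly
  have hAd : (A.map φ).degree < ((min a (b + 1) : ℕ) : WithBot ℕ) := by
    have h1 : (A.map φ).degree < (a : WithBot ℕ) := degree_map_le.trans_lt hA
    have h3 : (A.map φ).degree < ((b + 1 : ℕ) : WithBot ℕ) := by
      rw [hAB, degree_mul_one_add_X_lt_iff]; exact degree_map_le.trans_lt hB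
    rcases min_choice a (b + 1) with h | h <;> rw [h] <;> assumption
  have hA0 : A.map φ = 0 := by
    refine (isTruncation_map_thueMorseHalf.eq_zero_of_isPadeDenom s).1 (min a (b + 1))
      (max a (b + 1)) _ (by omega) (by omega)
      ⟨hAd, D.map φ, degree_map_le.trans_lt hd, ?_⟩ (by simp [hAB, CharTwo.add_self_eq_zero])
    have := Polynomial.map_dvd φ h2
    rw [dvd_sub_comm]
    simpa using this
  refine ⟨hA0, ?_⟩
  rw [hA0, eq_comm] at hAB
  exact (mul_eq_zero.1 hAB).resolve_left (by rw [add_comm]; exact X_add_C_ne_zero 1)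

open Polynomial in
/-- The Padé table of the Thue–Morse polynomials is normal on the antidiagonal `2 ^ s`. -/
theorem eq_zero_of_X_pow_dvd_mul_thueMorsePoly_sub {A B : ℤ[X]} {s a b : ℕ}
    (hab : a + b = 2 ^ s) (hA : A.degree < a) (hB : B.degree < b)
    (h : X ^ 2 ^ s ∣ A * thueMorsePoly s - B) : A = 0 ∧ B = 0 := by
  have hA0 : A = 0 := by
    by_contra hA0
    induction hN : A.leadingCoeff.natAbs using Nat.strong_induction_on generalizing A B with
    | _ N ih =>
      obtain ⟨hA2, hB2⟩ := map_eq_zero_of_X_pow_dvd hab hA hB h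
      obtain ⟨A, rfl⟩ := exists_eq_two_mul_of_map_eq_zero hA2
      obtain ⟨B, rfl⟩ := exists_eq_two_mul_of_map_eq_zero hB2
      rw [degree_two_mul] at hA hB
      rw [mul_assoc, ← mul_sub, X_pow_dvd_two_mul_iff] at h
      have hA1 : A ≠ 0 := right_ne_zero_of_mul hA0
      refine ih _ ?_ hA hB h hA1 rfl
      rw [← hN, leadingCoeff_mul, show (2 : ℤ[X]) = C 2 from rfl, leadingCoeff_C]
      have := leadingCoeff_ne_zero.2 hA1
      omega
  subst hA0
  refine ⟨rfl, eq_zero_of_X_pow_dvd_of_degree_lt (n := 2 ^ s) (by simpa using h)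
    (hB.trans_le ?_)⟩
  norm_cast; omega

open Polynomial in
theorem exists_map_eq_C_mul (P : ℚ[X]) : ∃ (d : ℤ) (Q : ℤ[X]), d ≠ 0 ∧
    Q.map (Int.castRingHom ℚ) = C (d : ℚ) * P := by
  obtain ⟨d, hd, h⟩ := IsLocalization.integerNormalization_spec (nonZeroDivisors ℤ) P
  refine ⟨d, IsLocalization.integerNormalization (nonZeroDivisors ℤ) P,
    nonZeroDivisors.ne_zero hd, ?_⟩
  rw [← smul_eq_C_mul, Int.cast_smul_eq_zsmul]
  exact h

open Polynomial in
theorem exists_map_eq_C_mul₂ (P P' : ℚ[X]) : ∃ (d : ℤ) (Q Q' : ℤ[X]), d ≠ 0 ∧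
    Q.map (Int.castRingHom ℚ) = C (d : ℚ) * P ∧ Q'.map (Int.castRingHom ℚ) = C (d : ℚ) * P' := by
  obtain ⟨d, Q, hd, hQ⟩ := exists_map_eq_C_mul P
  obtain ⟨d', Q', hd', hQ'⟩ := exists_map_eq_C_mul P'
  refine ⟨d * d', C d' * Q, C d * Q', mul_ne_zero hd hd', ?_, ?_⟩
  · simp [hQ]; ring
  · simp [hQ']; ring

open Polynomial in
theorem X_pow_dvd_map_iff {P : ℤ[X]} {n : ℕ} :
    X ^ n ∣ P.map (Int.castRingHom ℚ) ↔ X ^ n ∣ P := by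
  simp [X_pow_dvd_iff]

open Polynomial in
theorem eq_zero_of_X_pow_dvd_mul_map_thueMorsePoly_sub {A B : ℚ[X]} {s a b : ℕ}
    (hab : a + b = 2 ^ s) (hA : A.degree < a) (hB : B.degree < b)
    (h : X ^ 2 ^ s ∣ A * (thueMorsePoly s).map (Int.castRingHom ℚ) - B) : A = 0 ∧ B = 0 := by
  obtain ⟨d, A', B', hd, hA', hB'⟩ := exists_map_eq_C_mul₂ A B
  have hdQ : (d : ℚ) ≠ 0 := by exact_mod_cast hd
  have hinj : Function.Injective (Int.castRingHom ℚ) := RingHom.injective_int _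
  obtain ⟨rfl, rfl⟩ := eq_zero_of_X_pow_dvd_mul_thueMorsePoly_sub (A := A') (B := B') hab
    (by rwa [← degree_map_eq_of_injective hinj, hA', degree_C_mul hdQ])
    (by rwa [← degree_map_eq_of_injective hinj, hB', degree_C_mul hdQ])
    (by
      rw [← X_pow_dvd_map_iff, Polynomial.map_sub, Polynomial.map_mul, hA', hB', mul_assoc,
        ← mul_sub]
      exact h.mul_left _)
  simpa [hd] using And.intro hA'.symm hB'.symm

open Polynomial in
theorem exists_X_pow_dvd_mul_thueMorsePoly_sub_sub (P : ℚ[X]) {s a b : ℕ} (hab : a + b = 2 ^ s) :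
    ∃ A B : ℚ[X], A.degree < a ∧ B.degree < b ∧
      X ^ 2 ^ s ∣ A * (thueMorsePoly s).map (Int.castRingHom ℚ) - B - P := by
  set f := (thueMorsePoly s).map (Int.castRingHom ℚ) with hf
  let L : (degreeLT ℚ a × degreeLT ℚ b) →ₗ[ℚ] (Fin (2 ^ s) → ℚ) :=
    { toFun := fun v i => ((v.1 : ℚ[X]) * f - v.2).coeff i
      map_add' := fun v w => by ext i; simp [add_mul]; ring
      map_smul' := fun c v => by ext i; simp [mul_sub] }
  have hinj : Function.Injective L := by
    rw [← LinearMap.ker_eq_bot, LinearMap.ker_eq_bot']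
    rintro ⟨⟨A, hA⟩, ⟨B, hB⟩⟩ hL
    rw [mem_degreeLT] at hA hB
    obtain ⟨rfl, rfl⟩ := eq_zero_of_X_pow_dvd_mul_map_thueMorsePoly_sub hab hA hB
      (X_pow_dvd_iff.2 fun i hi => congrFun hL ⟨i, hi⟩)
    rfl
  have hfin (n : ℕ) : FiniteDimensional ℚ (degreeLT ℚ n) :=
    (degreeLTEquiv ℚ n).symm.finiteDimensional
  have hrank (n : ℕ) : Module.finrank ℚ (degreeLT ℚ n) = n := by
    simpa using (degreeLTEquiv ℚ n).finrank_eq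
  have hsurj : Function.Surjective L :=
    (LinearMap.injective_iff_surjective_of_finrank_eq_finrank (by simp [hrank, hab])).1 hinj
  obtain ⟨⟨⟨A, hA⟩, ⟨B, hB⟩⟩, hL⟩ := hsurj fun i => P.coeff i
  rw [mem_degreeLT] at hA hB
  refine ⟨A, B, hA, hB, X_pow_dvd_iff.2 fun i hi => ?_⟩
  rw [coeff_sub, sub_eq_zero]
  exact congrFun hL ⟨i, hi⟩

open Polynomial in
theorem exists_pade_pair {s a b : ℕ} (hab : a + b = 2 ^ s) :
    ∃ (A₁ B₁ A₂ B₂ : ℤ[X]) (d : ℤ), d ≠ 0 ∧ A₁.natDegree ≤ a ∧ A₂.natDegree ≤ a ∧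
      B₁.natDegree ≤ b ∧ B₂.natDegree ≤ b ∧ X ^ 2 ^ s ∣ A₁ * thueMorsePoly s - B₁ ∧
      X ^ 2 ^ s ∣ A₂ * thueMorsePoly s - B₂ ∧ A₁ * B₂ - A₂ * B₁ = C d * X ^ 2 ^ s := by
  set f := (thueMorsePoly s).map (Int.castRingHom ℚ) with hf
  obtain ⟨u, v, hu, hv, h₁⟩ := exists_X_pow_dvd_mul_thueMorsePoly_sub_sub (-X ^ a * f) hab
  obtain ⟨u', v', hu', hv', h₂⟩ := exists_X_pow_dvd_mul_thueMorsePoly_sub_sub (X ^ b) hab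
  rw [← hf] at h₁ h₂
  replace h₁ : X ^ 2 ^ s ∣ (X ^ a + u) * f - v := by convert h₁ using 1; ring
  replace h₂ : X ^ 2 ^ s ∣ u' * f - (X ^ b + v') := by convert h₂ using 1; ring
  have hdet : (X ^ a + u) * (X ^ b + v') - u' * v = X ^ 2 ^ s := by
    rw [← sub_eq_zero]
    refine eq_zero_of_X_pow_dvd_of_degree_lt (n := 2 ^ s) ?_ ?_
    · refine dvd_sub ?_ dvd_rfl
      convert dvd_sub (h₁.mul_left u') (h₂.mul_left (X ^ a + u)) using 1
      ring
    · have key {P Q : ℚ[X]} (hP : P.degree ≤ a) (hQ : Q.degree ≤ b)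
          (hPQ : P.degree < a ∨ Q.degree < b) : (P * Q).degree < (2 ^ s : ℕ) := by
        rcases eq_or_ne P 0 with rfl | hP0
        · rw [zero_mul, degree_zero]; exact WithBot.bot_lt_coe _
        rcases eq_or_ne Q 0 with rfl | hQ0
        · rw [mul_zero, degree_zero]; exact WithBot.bot_lt_coe _
        rw [degree_mul]
        rw [degree_eq_natDegree hP0, degree_eq_natDegree hQ0] at *
        norm_cast at *
        omega
      have : (X ^ a + u) * (X ^ b + v') - u' * v - X ^ 2 ^ s =
          X ^ a * v' + u * X ^ b + u * v' - u' * v := by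
        rw [← hab]; ring
      rw [this]
      refine (degree_sub_le _ _).trans_lt (max_lt ((degree_add_le _ _).trans_lt (max_lt
        ((degree_add_le _ _).trans_lt (max_lt ?_ ?_)) ?_)) ?_)
      · exact key (degree_X_pow_le a) hv'.le (.inr hv')
      · exact key hu.le (degree_X_pow_le b) (.inl hu)
      · exact key hu.le hv'.le (.inl hu)
      · exact key hu'.le hv.le (.inl hu')
  obtain ⟨d₁, A₁, B₁, hd₁, hA₁, hB₁⟩ := exists_map_eq_C_mul₂ (X ^ a + u) v
  obtain ⟨d₂, A₂, B₂, hd₂, hA₂, hB₂⟩ := exists_map_eq_C_mul₂ u' (X ^ b + v')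
  have hinj : Function.Injective (Int.castRingHom ℚ) := RingHom.injective_int _
  have hdeg {P : ℤ[X]} {Q : ℚ[X]} {c : ℤ} {n : ℕ} (h : P.map (Int.castRingHom ℚ) = C (c : ℚ) * Q)
      (hQ : Q.degree ≤ n) : P.natDegree ≤ n := by
    rw [← natDegree_map_eq_of_injective hinj, h]
    exact natDegree_le_iff_degree_le.2
      ((degree_mul_le _ _).trans ((add_le_add_left degree_C_le _).trans (by simpa using hQ)))
  refine ⟨A₁, B₁, A₂, B₂, d₁ * d₂, mul_ne_zero hd₁ hd₂, hdeg hA₁ ?_, hdeg hA₂ hu'.le,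
    hdeg hB₁ hv.le, hdeg hB₂ ?_, ?_, ?_, ?_⟩
  · exact (degree_add_le _ _).trans (max_le (degree_X_pow_le a) hu.le)
  · exact (degree_add_le _ _).trans (max_le (degree_X_pow_le b) hv'.le)
  · rw [← X_pow_dvd_map_iff, Polynomial.map_sub, Polynomial.map_mul, hA₁, hB₁, mul_assoc,
      ← mul_sub]
    exact h₁.mul_left _
  · rw [← X_pow_dvd_map_iff, Polynomial.map_sub, Polynomial.map_mul, hA₂, hB₂, mul_assoc,
      ← mul_sub]
    exact h₂.mul_left _
  · apply map_injective _ hinj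
    simp only [Polynomial.map_sub, Polynomial.map_mul, hA₁, hB₁, hA₂, hB₂, Polynomial.map_pow,
      map_X, map_C]
    rw [eq_intCast, Int.cast_mul, C_mul]
    linear_combination C (d₁ : ℚ) * C (d₂ : ℚ) * hdet

open Polynomial in
theorem exists_abs_eval_le {P : ℤ[X]} {n : ℕ} (hP : P.natDegree ≤ n) :
    ∃ M : ℤ, 0 < M ∧ ∀ Q : ℤ, 1 ≤ Q → |P.eval Q| ≤ M * Q ^ n := by
  refine ⟨∑ i ∈ Finset.range (n + 1), |P.coeff i| + 1,
    add_pos_of_nonneg_of_pos (Finset.sum_nonneg fun _ _ => abs_nonneg _) one_pos, fun Q hQ => ?_⟩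
  have hQn : 0 ≤ Q ^ n := by positivity
  rw [eval_eq_sum_range' (Nat.lt_succ_of_le hP), add_mul, Finset.sum_mul]
  refine (Finset.abs_sum_le_sum_abs _ _).trans ((Finset.sum_le_sum fun i hi => ?_).trans
    (le_add_of_nonneg_right (by simpa using hQn)))
  rw [abs_mul, abs_of_nonneg (show 0 ≤ Q ^ i by positivity)]
  exact mul_le_mul_of_nonneg_left
    (pow_le_pow_right₀ hQ (Nat.lt_succ_iff.1 (Finset.mem_range.1 hi))) (abs_nonneg _)

open Polynomial in
theorem exists_pade_values_of_add_eq {s a b : ℕ} (hab : a + b = 2 ^ s) :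
    ∃ M : ℤ, 0 < M ∧ ∀ Q : ℤ, 1 ≤ Q → ∃ A₁ B₁ A₂ B₂ : ℤ,
      |A₁| ≤ M * Q ^ a ∧ |A₂| ≤ M * Q ^ a ∧ |B₁| ≤ M * Q ^ b ∧ |B₂| ≤ M * Q ^ b ∧
      Q ^ 2 ^ s ∣ A₁ * (thueMorsePoly s).eval Q - B₁ ∧
      Q ^ 2 ^ s ∣ A₂ * (thueMorsePoly s).eval Q - B₂ ∧ A₁ * B₂ - A₂ * B₁ ≠ 0 := by
  obtain ⟨A₁, B₁, A₂, B₂, d, hd, hA₁, hA₂, hB₁, hB₂, h₁, h₂, hdet⟩ := exists_pade_pair hab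
  obtain ⟨M₁, hM₁, hM₁'⟩ := exists_abs_eval_le hA₁
  obtain ⟨M₂, hM₂, hM₂'⟩ := exists_abs_eval_le hA₂
  obtain ⟨M₃, hM₃, hM₃'⟩ := exists_abs_eval_le hB₁
  obtain ⟨M₄, hM₄, hM₄'⟩ := exists_abs_eval_le hB₂
  refine ⟨M₁ + M₂ + M₃ + M₄, by positivity, fun Q hQ => ⟨A₁.eval Q, B₁.eval Q, A₂.eval Q,
    B₂.eval Q, (hM₁' Q hQ).trans ?_, (hM₂' Q hQ).trans ?_, (hM₃' Q hQ).trans ?_,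
    (hM₄' Q hQ).trans ?_, ?_, ?_, ?_⟩⟩
  any_goals exact mul_le_mul_of_nonneg_right (by linarith) (by positivity)
  · simpa using eval_dvd (x := Q) h₁
  · simpa using eval_dvd (x := Q) h₂
  · have := congrArg (eval Q) hdet
    rw [eval_sub, eval_mul, eval_mul, eval_mul, eval_C, eval_pow, eval_X] at this
    rw [this]
    positivity

theorem exists_pade_values (s : ℕ) :
    ∃ M : ℤ, 0 < M ∧ ∀ a b : ℕ, a + b = 2 ^ s → ∀ Q : ℤ, 1 ≤ Q → ∃ A₁ B₁ A₂ B₂ : ℤ,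
      |A₁| ≤ M * Q ^ a ∧ |A₂| ≤ M * Q ^ a ∧ |B₁| ≤ M * Q ^ b ∧ |B₂| ≤ M * Q ^ b ∧
      Q ^ 2 ^ s ∣ A₁ * (thueMorsePoly s).eval Q - B₁ ∧
      Q ^ 2 ^ s ∣ A₂ * (thueMorsePoly s).eval Q - B₂ ∧ A₁ * B₂ - A₂ * B₁ ≠ 0 := by
  choose! M hM h using fun (a b : ℕ) (hab : a + b = 2 ^ s) => exists_pade_values_of_add_eq hab
  have hpos : ∀ x ∈ Finset.HasAntidiagonal.antidiagonal (2 ^ s), 0 < M x.1 x.2 := fun x hx =>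
    hM _ _ (Finset.HasAntidiagonal.mem_antidiagonal.1 hx)
  have hle (a b : ℕ) (hab : a + b = 2 ^ s) :
      M a b ≤ ∑ x ∈ Finset.HasAntidiagonal.antidiagonal (2 ^ s), M x.1 x.2 :=
    Finset.single_le_sum (f := fun x : ℕ × ℕ => M x.1 x.2) (fun x hx => (hpos x hx).le)
      (Finset.HasAntidiagonal.mem_antidiagonal.2 hab : (a, b) ∈ _)
  refine ⟨∑ x ∈ Finset.HasAntidiagonal.antidiagonal (2 ^ s), M x.1 x.2,
    (hM _ _ (zero_add _)).trans_le (hle 0 _ (zero_add _)), fun a b hab Q hQ => ?_⟩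
  obtain ⟨A₁, B₁, A₂, B₂, h₁, h₂, h₃, h₄, h₅⟩ := h a b hab Q hQ
  have hmul (c : ℕ) : M a b * Q ^ c ≤
      (∑ x ∈ Finset.HasAntidiagonal.antidiagonal (2 ^ s), M x.1 x.2) * Q ^ c :=
    mul_le_mul_of_nonneg_right (hle a b hab) (by positivity)
  exact ⟨A₁, B₁, A₂, B₂, h₁.trans (hmul _), h₂.trans (hmul _), h₃.trans (hmul _),
    h₄.trans (hmul _), h₅⟩

open Polynomial in
theorem thueMorsePoly_add (r s : ℕ) :
    thueMorsePoly (r + s) = thueMorsePoly r * expand ℤ (2 ^ r) (thueMorsePoly s) := by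
  induction r with
  | zero => simp [thueMorsePoly]
  | succ r ih =>
    rw [show r + 1 + s = (r + s) + 1 by ring, thueMorsePoly, ih, thueMorsePoly, map_mul,
      expand_expand, pow_succ', mul_assoc]

open Polynomial in
theorem mul_abs_eval_thueMorsePoly_le (r : ℕ) {x : ℤ} (hx : 1 ≤ x) :
    x * |(thueMorsePoly r).eval x| ≤ x ^ 2 ^ r := by
  induction r generalizing x with
  | zero => simp [thueMorsePoly]
  | succ r ih =>
    rw [thueMorsePoly, eval_mul, expand_eval, abs_mul, pow_succ' 2 r, pow_mul]
    refine le_trans ?_ (ih (x := x ^ 2) (one_le_pow₀ hx))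
    have h : |(1 - X : ℤ[X]).eval x| ≤ x := by
      simp only [eval_sub, eval_one, eval_X]; rw [abs_le]; constructor <;> linarith
    rw [← mul_assoc, sq]
    exact mul_le_mul_of_nonneg_right (mul_le_mul_of_nonneg_left h (by linarith)) (abs_nonneg _)

open Polynomial in
theorem thueMorsePoly_eq_sum {t : ℕ → ℤ} (ht0 : t 0 = 1) (hte : ∀ n, t (2 * n) = t n)
    (hto : ∀ n, t (2 * n + 1) = -t n) (k : ℕ) :
    thueMorsePoly k = ∑ i ∈ Finset.range (2 ^ k), C (t i) * X ^ i := by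
  have hsum (g : ℕ → ℤ[X]) (n : ℕ) : ∑ i ∈ Finset.range (2 * n), g i =
      ∑ i ∈ Finset.range n, (g (2 * i) + g (2 * i + 1)) := by
    induction n with
    | zero => simp
    | succ n ih =>
      rw [show 2 * (n + 1) = 2 * n + 1 + 1 by ring, Finset.sum_range_succ, Finset.sum_range_succ,
        Finset.sum_range_succ, ih, add_assoc]
  induction k with
  | zero => simp [thueMorsePoly, ht0]
  | succ k ih =>
    rw [thueMorsePoly, ih, pow_succ', hsum, map_sum, Finset.mul_sum]
    refine Finset.sum_congr rfl fun i _ => ?_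
    rw [hte, hto, map_mul, expand_C, map_pow, expand_X, C_neg]
    ring

open Polynomial in
theorem exists_le_mul_sq (s : ℕ) : ∃ M : ℤ, 0 < M ∧ ∀ (p : ℤ), 2 ≤ p → ∀ (r : ℕ) (q x y : ℤ),
    0 < x → y ≠ 0 → p ^ 2 ^ (r + s) ∣ x * (thueMorsePoly (r + s)).eval p - y →
    q * x * |y| ≤ p ^ 2 ^ (r + s) → q ≤ 4 * M ^ 2 * (p ^ 2 ^ r) ^ 2 := by
  obtain ⟨M, hM, hpade⟩ := exists_pade_values s
  refine ⟨M, hM, fun p hp r q x y hx hy hdvd hle => ?_⟩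
  by_contra! hq
  have hf : (thueMorsePoly (r + s)).eval p =
      (thueMorsePoly r).eval p * (thueMorsePoly s).eval (p ^ 2 ^ r) := by
    rw [thueMorsePoly_add, eval_mul, expand_eval]
  have hF : |(thueMorsePoly r).eval p| ≤ p ^ 2 ^ r :=
    (le_mul_of_one_le_left (abs_nonneg _) (by linarith)).trans
      (mul_abs_eval_thueMorsePoly_le r (by linarith))
  rw [hf] at hdvd
  rw [show p ^ 2 ^ (r + s) = (p ^ 2 ^ r) ^ 2 ^ s by rw [← pow_mul, ← pow_add]] at hdvd hle
  have hQ : 2 ≤ p ^ 2 ^ r := hp.trans (le_self_pow₀ (by linarith) (by positivity))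
  generalize p ^ 2 ^ r = Q at *
  generalize (thueMorsePoly r).eval p = F at *
  have hy1 : 1 ≤ |y| := Int.one_le_abs hy
  have hex : ∃ a : ℕ, 2 * M * x < Q ^ a := pow_unbounded_of_one_lt _ (by linarith)
  obtain ⟨a, ha, hamin⟩ : ∃ a : ℕ, 2 * M * x < Q ^ (a + 1) ∧ Q ^ a ≤ 2 * M * x := by
    obtain ⟨c, hc⟩ : ∃ c, Nat.find hex = c + 1 := by
      refine Nat.exists_eq_succ_of_ne_zero fun h0 => ?_
      have := (Nat.find_eq_zero hex).1 h0
      rw [pow_zero] at this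
      nlinarith [mul_pos hM hx]
    exact ⟨c, hc ▸ Nat.find_spec hex, not_lt.1 (Nat.find_min hex (by omega))⟩
  have hq0 : 0 < q := lt_of_le_of_lt (by positivity) hq
  have hMQ : 2 * M * Q ^ (a + 2) < q * x := by
    calc 2 * M * Q ^ (a + 2) = 2 * M * Q ^ 2 * Q ^ a := by ring
      _ ≤ 2 * M * Q ^ 2 * (2 * M * x) := by gcongr
      _ = 4 * M ^ 2 * Q ^ 2 * x := by ring
      _ < q * x := by gcongr
  have han : a + 2 ≤ 2 ^ s := by
    have : Q ^ (a + 2) < Q ^ 2 ^ s := by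
      calc Q ^ (a + 2) ≤ 2 * M * Q ^ (a + 2) :=
            le_mul_of_one_le_left (by positivity) (by linarith)
        _ < q * x := hMQ
        _ ≤ q * x * |y| := le_mul_of_one_le_right (by positivity) hy1
        _ ≤ Q ^ 2 ^ s := hle
    exact ((pow_lt_pow_iff_right₀ (by linarith)).1 this).le
  obtain ⟨b, hab⟩ := Nat.exists_eq_add_of_le han
  obtain ⟨A₁, B₁, A₂, B₂, hA₁, hA₂, hB₁, hB₂, h₁, h₂, hdet⟩ :=
    hpade (a + 2) b hab.symm Q (by linarith)
  have key {A B : ℤ} (hA : |A| ≤ M * Q ^ (a + 2)) (hB : |B| ≤ M * Q ^ b)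
      (h : Q ^ 2 ^ s ∣ A * (thueMorsePoly s).eval Q - B) : x * F * B - y * A = 0 := by
    refine Int.eq_zero_of_abs_lt_dvd (m := Q ^ 2 ^ s) ?_ ?_
    · have := dvd_sub (hdvd.mul_left A) (h.mul_left (x * F))
      rwa [show A * (x * (F * (thueMorsePoly s).eval Q) - y) -
        x * F * (A * (thueMorsePoly s).eval Q - B) = x * F * B - y * A by ring] at this
    · have e₁ : 2 * |x * F * B| < Q ^ 2 ^ s := by
        rw [abs_mul, abs_mul, abs_of_pos hx]
        calc 2 * (x * |F| * |B|) ≤ 2 * (x * Q * (M * Q ^ b)) := by gcongr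
          _ = 2 * M * x * Q ^ (b + 1) := by ring
          _ < Q ^ (a + 1) * Q ^ (b + 1) := by gcongr
          _ = Q ^ 2 ^ s := by rw [hab]; ring
      have e₂ : 2 * |y * A| < Q ^ 2 ^ s := by
        rw [abs_mul]
        calc 2 * (|y| * |A|) ≤ 2 * (|y| * (M * Q ^ (a + 2))) := by gcongr
          _ = 2 * M * Q ^ (a + 2) * |y| := by ring
          _ < q * x * |y| := by gcongr
          _ ≤ Q ^ 2 ^ s := hle
      have := abs_sub (x * F * B) (y * A)
      linarith
  have k₁ := key hA₁ hB₁ h₁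
  have k₂ := key hA₂ hB₂ h₂
  refine mul_ne_zero hy hdet ?_
  linear_combination B₁ * k₂ - B₂ * k₁

theorem GenContFract.exists_int_eq_contsAux {K : Type*} [Field K] [LinearOrder K] [FloorRing K]
    [IsStrictOrderedRing K] (v : K) (n : ℕ) :
    (∃ a b : ℤ, (GenContFract.of v).contsAux n = ⟨(a : K), (b : K)⟩) ∧
      ∃ a b : ℤ, (GenContFract.of v).contsAux (n + 1) = ⟨(a : K), (b : K)⟩ := by
  induction n with
  | zero =>
    refine ⟨⟨1, 0, by simp [contsAux]⟩, ⟨⌊v⌋, 1, by simp [contsAux]⟩⟩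
  | succ n ih =>
    refine ⟨ih.2, ?_⟩
    obtain ⟨⟨a, b, h⟩, ⟨a', b', h'⟩⟩ := ih
    rcases hs : (GenContFract.of v).s.get? n with _ | gp
    · exact ⟨a', b', by rw [← h', contsAux, hs]⟩
    · obtain ⟨hgp, z, hz⟩ := of_partNum_eq_one_and_exists_int_partDen_eq hs
      exact ⟨z * a' + a, z * b' + b, by
        rw [contsAux_recurrence hs h h', hgp, hz]; simp⟩

/-- A partial quotient `q` of `v` yields a rational approximation `y / x ≠ v` with
`|v - y / x| ≤ 1 / (q x²)`. -/
theorem GenContFract.exists_approx_of_mem_partDens_s12 {K : Type*} [Field K] [LinearOrder K]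
    [FloorRing K] [IsStrictOrderedRing K] {v q : K} (hq : q ∈ (GenContFract.of v).partDens) :
    ∃ (x y m : ℤ), q = m ∧ 0 < x ∧ v * x - y ≠ 0 ∧ q * x * |v * x - y| ≤ 1 := by
  obtain ⟨n, hn⟩ := Stream'.Seq.mem_iff_exists_get?.1 hq
  obtain ⟨m, hm⟩ := exists_int_eq_of_partDen hn.symm
  obtain ⟨gp, hgp, hgq⟩ := exists_s_b_of_partDen hn.symm
  obtain ⟨ifp, hifp, -⟩ := IntFractPair.exists_succ_get?_stream_of_gcf_of_get?_eq_some hgp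
  obtain ⟨ifp', hifp', hfr, -⟩ := IntFractPair.succ_nth_stream_eq_some_iff.1 hifp
  have hnt : ¬(GenContFract.of v).TerminatedAt n := by
    rw [terminatedAt_iff_s_none, hgp]; simp
  have hden : 0 < (GenContFract.of v).dens n := by
    refine lt_of_lt_of_le ?_ (succ_nth_fib_le_of_nth_den (v := v) (n := n)
      (.inr (mt (terminated_stable n.pred_le) hnt)))
    exact_mod_cast Nat.fib_pos.2 n.succ_pos
  have happ := abs_sub_convergents_le' hn.symm
  have hq1 : 1 ≤ q := of_one_le_get?_partDen hn.symm
  have hne : v - (GenContFract.of v).convs n ≠ 0 := by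
    rw [sub_convs_eq hifp', if_neg hfr]
    have hpB : 0 ≤ ((GenContFract.of v).contsAux n).b := zero_le_of_contsAux_b
    have hB : 0 < ((GenContFract.of v).contsAux (n + 1)).b := hden
    have : 0 < ifp'.fr := (IntFractPair.nth_stream_fr_nonneg hifp').lt_of_ne' hfr
    positivity
  obtain ⟨-, y, x, hxy⟩ := exists_int_eq_contsAux v n
  have hx : (GenContFract.of v).dens n = x := by
    rw [den_eq_conts_b, nth_cont_eq_succ_nth_contAux, hxy]
  have hy : (GenContFract.of v).nums n = y := by
    rw [num_eq_conts_a, nth_cont_eq_succ_nth_contAux, hxy]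
  rw [hx] at hden
  rw [convs, hx, hy] at happ hne
  have he : v * x - y = (v - y / x) * x := by field_simp
  refine ⟨x, y, m, hm, by exact_mod_cast hden, ?_, ?_⟩
  · rw [he]; exact mul_ne_zero hne hden.ne'
  · rw [he, abs_mul, abs_of_pos hden]
    rw [le_div_iff₀ (by positivity)] at happ
    linarith

theorem tm_partial_quotients_of_z_two_pow_small (p : ℕ) [Fact p.Prime]
    (t : ℕ → ℤ) (ht0 : t 0 = 1)
    (hte : ∀ n, t (2 * n) = t n) (hto : ∀ n, t (2 * n + 1) = - t n)
    (z : ℕ → ℚ) (hz : ∀ m, z m = ∑ i ∈ Finset.range m, (t i : ℚ) / (p : ℚ) ^ (m - i)) :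
    ∀ ε : ℝ, 0 < ε → ∃ K : ℕ, ∀ k : ℕ, K ≤ k →
      ∀ q ∈ (GenContFract.of (z (2 ^ k))).partDens,
        (q : ℝ) < (p : ℝ) ^ (ε * 2 ^ k) := by
  intro ε hε
  have hp2 : 2 ≤ p := (Fact.out : p.Prime).two_le
  have hp2R : (2 : ℝ) ≤ p := by exact_mod_cast hp2
  have hzN (k : ℕ) : z (2 ^ k) * (p : ℚ) ^ 2 ^ k = ((thueMorsePoly k).eval (p : ℤ) : ℤ) := by
    rw [hz, thueMorsePoly_eq_sum ht0 hte hto, Polynomial.eval_finsetSum, Int.cast_sum,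
      Finset.sum_mul]
    refine Finset.sum_congr rfl fun i hi => ?_
    have : (p : ℚ) ^ 2 ^ k = (p : ℚ) ^ (2 ^ k - i) * (p : ℚ) ^ i := by
      rw [← pow_add, Nat.sub_add_cancel (Finset.mem_range.1 hi).le]
    rw [this]
    have : (p : ℚ) ≠ 0 := by positivity
    field_simp
    simp
  obtain ⟨s, hs⟩ := pow_unbounded_of_one_lt (4 / ε) (one_lt_two : (1 : ℝ) < 2)
  obtain ⟨M, hM, hbound⟩ := exists_le_mul_sq s
  obtain ⟨K, hK⟩ : ∃ K : ℕ, ∀ k, K ≤ k → 4 * (M : ℝ) ^ 2 < (p : ℝ) ^ (ε / 2 * 2 ^ k) := by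
    have h : Filter.Tendsto (fun k : ℕ => (p : ℝ) ^ (ε / 2 * 2 ^ k)) Filter.atTop Filter.atTop :=
      (tendsto_rpow_atTop_of_base_gt_one _ (by linarith)).comp
        ((tendsto_pow_atTop_atTop_of_one_lt one_lt_two).const_mul_atTop (by positivity))
    exact Filter.eventually_atTop.1 (h.eventually_gt_atTop _)
  refine ⟨max K s, fun k hk q hq => ?_⟩
  obtain ⟨r, rfl⟩ := Nat.exists_eq_add_of_le' ((le_max_right K s).trans hk)
  obtain ⟨x, y, m, rfl, hx, hne, hle⟩ := GenContFract.exists_approx_of_mem_partDens_s12 hq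
  have hpos : (0 : ℚ) < (p : ℚ) ^ 2 ^ (r + s) := by positivity
  set N := (thueMorsePoly (r + s)).eval (p : ℤ) with hN
  have hy' : ((x * N - (p : ℤ) ^ 2 ^ (r + s) * y : ℤ) : ℚ) =
      (z (2 ^ (r + s)) * x - y) * (p : ℚ) ^ 2 ^ (r + s) := by
    push_cast
    linear_combination -(x : ℚ) * hzN (r + s)
  have hm := hbound p (by exact_mod_cast hp2) r m x (x * N - (p : ℤ) ^ 2 ^ (r + s) * y) hx
    (by
      rw [← Int.cast_ne_zero (α := ℚ), hy']
      exact mul_ne_zero hne hpos.ne')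
    ⟨y, by ring⟩
    (by
      rw [← Int.cast_le (R := ℚ), Int.cast_mul, Int.cast_abs, hy', abs_mul, abs_of_pos hpos]
      push_cast
      rw [← mul_assoc]
      exact mul_le_of_le_one_left hpos.le hle)
  have hexp : (2 : ℝ) ^ r * 2 ≤ ε / 2 * 2 ^ (r + s) := by
    rw [div_lt_iff₀ hε] at hs
    rw [pow_add]
    nlinarith [pow_pos (two_pos : (0 : ℝ) < 2) r]
  have hmR : (m : ℝ) ≤ 4 * (M : ℝ) ^ 2 * ((p : ℝ) ^ 2 ^ r) ^ 2 := by exact_mod_cast hm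
  rw [Rat.cast_intCast]
  calc (m : ℝ) ≤ 4 * (M : ℝ) ^ 2 * ((p : ℝ) ^ 2 ^ r) ^ 2 := hmR
    _ = 4 * (M : ℝ) ^ 2 * (p : ℝ) ^ ((2 : ℝ) ^ r * 2) := by
      rw [← pow_mul, ← Real.rpow_natCast (p : ℝ)]; push_cast; rfl
    _ ≤ 4 * (M : ℝ) ^ 2 * (p : ℝ) ^ (ε / 2 * 2 ^ (r + s)) := by
      gcongr; linarith
    _ < (p : ℝ) ^ (ε / 2 * 2 ^ (r + s)) * (p : ℝ) ^ (ε / 2 * 2 ^ (r + s)) := by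
      gcongr
      exact hK _ ((le_max_left K s).trans hk)
    _ = (p : ℝ) ^ (ε * 2 ^ (r + s)) := by
      rw [← Real.rpow_add (by positivity)]; congr 1; ring
end

section
/- For every integer k ≥ 1, the prefix of length 4^k of the Thue–Morse word is a palindrome; that is, t_j = t_{4^k − 1 − j} for all integers j with 0 ≤ j ≤ 4^k − 1. -/
/-- Reversing the prefix of length `2 ^ m` of a Thue–Morse word multiplies it by `(-1) ^ m`. -/
lemma thueMorse_reverse_prefix {t : ℕ → ℤ}
    (hte : ∀ n, t (2 * n) = t n) (hto : ∀ n, t (2 * n + 1) = - t n) (m : ℕ) :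
    ∀ i j : ℕ, i + j + 1 = 2 ^ m → t i = (-1) ^ m * t j := by
  induction m with
  | zero =>
    intro i j h
    obtain ⟨rfl, rfl⟩ : i = 0 ∧ j = 0 := by
      rw [pow_zero] at h
      omega
    simp
  | succ m ih =>
    intro i j h
    rw [pow_succ] at h
    obtain ⟨a, rfl | rfl⟩ := Nat.even_or_odd' i
    · obtain ⟨b, rfl⟩ : ∃ b, j = 2 * b + 1 := ⟨j / 2, by omega⟩
      rw [hte, hto, ih a b (by omega)]
      ring
    · obtain ⟨b, rfl⟩ : ∃ b, j = 2 * b := ⟨j / 2, by omega⟩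
      rw [hte, hto, ih a b (by omega)]
      ring

theorem tm_prefix_palindrome
    (t : ℕ → ℤ) (ht0 : t 0 = 1)
    (hte : ∀ n, t (2 * n) = t n) (hto : ∀ n, t (2 * n + 1) = - t n) :
    ∀ k : ℕ, 1 ≤ k → ∀ j : ℕ, j ≤ 4 ^ k - 1 → t j = t (4 ^ k - 1 - j) := by
  intro k _ j hj
  have hpow : (4 : ℕ) ^ k = 2 ^ (2 * k) := by rw [pow_mul]; norm_num
  have hpos : 0 < (4 : ℕ) ^ k := by positivity
  have h := thueMorse_reverse_prefix hte hto (2 * k) j (4 ^ k - 1 - j) (by omega)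
  simpa [pow_mul] using h
end
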